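/- For every positive integer m there exists an integer D(m) with the following property: for all integers d ≥ D(m), all r ≥ 1 and all multiplicities m_1, …, m_r with 1 ≤ m_i ≤ m such that (d+1)(d+2)/2 − Σ_{i=1}^r m_i(m_i+1)/2 ≥ 1, there exist pairwise distinct points P_1, …, P_r ∈ ℙ²(ℂ) and an irreducible homogeneous polynomial F ∈ ℂ[X,Y,Z] of degree d such that F has an ordinary singularity of multiplicity m_i at each P_i, and at every point of the curve {F = 0} other than P_1, …, P_r at least one first partial derivative of F is nonzero (i.e., the curve is smooth away from the P_i). In particular, the variety V(d; m_1, …, m_r) of irreducible plane curves of degree d with exactly r ordinary singularities of multiplicities m_1, …, m_r is nonempty. -/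

import Mathlib

open MvPolynomial

noncomputable section

abbrev Proj2 := Projectivization ℂ (Fin 3 → ℂ)

/-- The iterated partial derivative operator `∂₀^{k 0} ∂₁^{k 1} ∂₂^{k 2}`. -/
def diffOp (k : Fin 3 → ℕ) : MvPolynomial (Fin 3) ℂ →ₗ[ℂ] MvPolynomial (Fin 3) ℂ :=
  (((pderiv (0 : Fin 3)).toLinearMap ^ k 0) * ((pderiv (1 : Fin 3)).toLinearMap ^ k 1) *
    ((pderiv (2 : Fin 3)).toLinearMap ^ k 2) :
    Module.End ℂ (MvPolynomial (Fin 3) ℂ))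

/-- Polynomials all of whose partial derivatives of total order `< m` vanish at `p`. -/
def vanishingSubmodule (m : ℕ) (p : Fin 3 → ℂ) : Submodule ℂ (MvPolynomial (Fin 3) ℂ) :=
  ⨅ k ∈ {k : Fin 3 → ℕ | k 0 + k 1 + k 2 < m},
    LinearMap.ker ((aeval p).toLinearMap ∘ₗ diffOp k)

/-- The space of homogeneous polynomials of degree `d` vanishing to order at least `mi i`
at the point `P i`, for each `i`. -/
def Lspace (d : ℕ) {r : ℕ} (P : Fin r → Proj2) (mi : Fin r → ℕ) :
    Submodule ℂ (MvPolynomial (Fin 3) ℂ) :=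
  homogeneousSubmodule (Fin 3) ℂ d ⊓ ⨅ i, vanishingSubmodule (mi i) (P i).rep

/-- The Zariski topology on a complex vector space: generated by the nonvanishing loci of
polynomial functions (polynomials in finitely many linear forms). -/
def vectorZariski (V : Type*) [AddCommGroup V] [Module ℂ V] : TopologicalSpace V :=
  TopologicalSpace.generateFrom
    { U | ∃ (n : ℕ) (f : MvPolynomial (Fin n) ℂ) (φ : Fin n → (V →ₗ[ℂ] ℂ)),
        U = {v | MvPolynomial.eval (fun i => φ i v) f ≠ 0} }

/-- The Zariski topology on the space of `r`-tuples of points of `ℙ²(ℂ)`, obtained as the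
quotient topology from the Zariski topology on tuples of nonzero vectors in `ℂ³`. -/
def projTupleZariski (r : ℕ) : TopologicalSpace (Fin r → Proj2) :=
  TopologicalSpace.coinduced
    (fun v : {v : Fin r → Fin 3 → ℂ // ∀ i, v i ≠ 0} =>
      fun i => Projectivization.mk ℂ (v.1 i) (v.2 i))
    (TopologicalSpace.induced Subtype.val (vectorZariski (Fin r → Fin 3 → ℂ)))

/-- The Zariski topology on the projectivization of a complex vector space. -/
def projZariski (V : Type*) [AddCommGroup V] [Module ℂ V] :
    TopologicalSpace (Projectivization ℂ V) :=
  TopologicalSpace.coinduced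
    (fun v : {v : V // v ≠ 0} => Projectivization.mk ℂ v.1 v.2)
    (TopologicalSpace.induced Subtype.val (vectorZariski V))

/-- The dehomogenization of `F` in the affine chart `(x, y) ↦ A ⬝ (x, y, 1)`. -/
def chartPoly (A : Matrix (Fin 3) (Fin 3) ℂ) (F : MvPolynomial (Fin 3) ℂ) :
    MvPolynomial (Fin 2) ℂ :=
  aeval (fun j : Fin 3 => ∑ i : Fin 3, C (A j i) * ![X 0, X 1, (1 : MvPolynomial (Fin 2) ℂ)] i) F

/-- `F` has an ordinary singularity of multiplicity `m` at `P`: in some affine chart centered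
at `P`, the lowest-degree homogeneous part of the dehomogenization of `F` has degree exactly
`m` and is a squarefree binary form. -/
def HasOrdinarySingularity (m : ℕ) (P : Proj2) (F : MvPolynomial (Fin 3) ℂ) : Prop :=
  ∃ A : Matrix (Fin 3) (Fin 3) ℂ, IsUnit A.det ∧
    ∃ h : A.mulVec ![0, 0, 1] ≠ 0,
      Projectivization.mk ℂ (A.mulVec ![0, 0, 1]) h = P ∧
      (∀ k < m, homogeneousComponent k (chartPoly A F) = 0) ∧
      homogeneousComponent m (chartPoly A F) ≠ 0 ∧
      Squarefree (homogeneousComponent m (chartPoly A F))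

/-- The curve `{F = 0}` is smooth away from the points `P i`: at every point of the curve
other than the `P i`, some first partial derivative of `F` is nonzero. -/
def SmoothAwayFrom {r : ℕ} (F : MvPolynomial (Fin 3) ℂ) (P : Fin r → Proj2) : Prop :=
  ∀ Q : Proj2, eval Q.rep F = 0 → (∀ i, Q ≠ P i) →
    ∃ j : Fin 3, eval Q.rep (pderiv j F) ≠ 0

/-- Polynomials in two variables over `ℂ`. -/
abbrev BiPoly := MvPolynomial (Fin 2) ℂ

/-- The maximal ideal of the point `(a, b)` of the affine plane. -/
def pointIdeal (a b : ℂ) : Ideal BiPoly := Ideal.span {X 0 - C a, X 1 - C b}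

/-- Polynomials of weighted degree at most `e` for the weights `(A, 1)`. -/
def weightedSpace (A e : ℕ) : Submodule ℂ BiPoly :=
  restrictSupport ℂ {n | A * n 0 + n 1 ≤ e}

theorem X_zero_sub_mem_pointIdeal (a b : ℂ) : X 0 - C a ∈ pointIdeal a b :=
  Ideal.subset_span (by simp)

theorem X_one_sub_mem_pointIdeal (a b : ℂ) : X 1 - C b ∈ pointIdeal a b :=
  Ideal.subset_span (by simp)

theorem sub_C_eval_mem_pointIdeal (a b : ℂ) (f : BiPoly) :
    f - C (eval ![a, b] f) ∈ pointIdeal a b := by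
  induction f using MvPolynomial.induction_on with
  | C c => simp
  | add p q hp hq =>
    have := add_mem hp hq
    simp only [map_add]
    convert this using 1
    ring
  | mul_X p i hp =>
    have hX : (X i : BiPoly) - C (![a, b] i) ∈ pointIdeal a b := by
      fin_cases i
      · exact X_zero_sub_mem_pointIdeal a b
      · exact X_one_sub_mem_pointIdeal a b
    have := add_mem (Ideal.mul_mem_left _ (X i) hp)
      (Ideal.mul_mem_left _ (C (eval ![a, b] p)) hX)
    convert this using 1
    simp only [map_mul, eval_X]
    ring

theorem exists_mul_sub_one_mem_pow {a b : ℂ} {f : BiPoly} (hf : eval ![a, b] f ≠ 0) (k : ℕ) :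
    ∃ u, f * u - 1 ∈ pointIdeal a b ^ k := by
  have h : IsCoprime (Ideal.span {f}) (pointIdeal a b) := by
    rw [Ideal.isCoprime_iff_exists]
    refine ⟨f * C (eval ![a, b] f)⁻¹, Ideal.mul_mem_right _ _ (Ideal.mem_span_singleton_self f),
      1 - f * C (eval ![a, b] f)⁻¹, ?_, by ring⟩
    have := Ideal.mul_mem_right (-C (eval ![a, b] f)⁻¹) _ (sub_C_eval_mem_pointIdeal a b f)
    convert this using 1
    have h1 : (C (eval ![a, b] f) : BiPoly) * C (eval ![a, b] f)⁻¹ = 1 := by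
      rw [← C_mul, mul_inv_cancel₀ hf, C_1]
    linear_combination -h1
  have h2 := h.pow_right (n := k)
  rw [Ideal.isCoprime_iff_exists] at h2
  obtain ⟨i, hi, j, hj, hij⟩ := h2
  obtain ⟨u, rfl⟩ := Ideal.mem_span_singleton.1 hi
  refine ⟨u, ?_⟩
  have : f * u - 1 = -j := by linear_combination hij
  rw [this]
  exact neg_mem hj

theorem mem_weightedSpace {A e : ℕ} {g : BiPoly} :
    g ∈ weightedSpace A e ↔ ∀ n, coeff n g ≠ 0 → A * n 0 + n 1 ≤ e := by
  simp [weightedSpace, mem_restrictSupport_iff, Set.subset_def]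

theorem weightedSpace_mono {A e e' : ℕ} (h : e ≤ e') : weightedSpace A e ≤ weightedSpace A e' :=
  fun _ hg => mem_weightedSpace.2 fun n hn => (mem_weightedSpace.1 hg n hn).trans h

theorem mul_mem_weightedSpace {A e e' : ℕ} {f g : BiPoly} (hf : f ∈ weightedSpace A e)
    (hg : g ∈ weightedSpace A e') : f * g ∈ weightedSpace A (e + e') := by
  classical
  rw [mem_weightedSpace] at *
  intro n hn
  have := support_mul f g (mem_support_iff.2 hn)
  obtain ⟨a, ha, b, hb, rfl⟩ := Finset.mem_add.1 this
  have h1 := hf a (mem_support_iff.1 ha)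
  have h2 := hg b (mem_support_iff.1 hb)
  simp only [Finsupp.add_apply, mul_add]
  omega

theorem C_mem_weightedSpace (A : ℕ) (c : ℂ) : C c ∈ weightedSpace A 0 := by
  classical
  rw [mem_weightedSpace]
  intro n hn
  rw [coeff_C] at hn
  have : (0 : Fin 2 →₀ ℕ) = n := by by_contra h; simp [h] at hn
  simp [← this]

theorem X_zero_mem_weightedSpace (A : ℕ) : X 0 ∈ weightedSpace A A := by
  classical
  rw [mem_weightedSpace]
  intro n hn
  rw [coeff_X] at hn
  have : Finsupp.single 0 1 = n := by by_contra h; simp [h] at hn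
  simp [← this]

theorem X_one_mem_weightedSpace (A : ℕ) : X 1 ∈ weightedSpace A 1 := by
  classical
  rw [mem_weightedSpace]
  intro n hn
  rw [coeff_X] at hn
  have : Finsupp.single 1 1 = n := by by_contra h; simp [h] at hn
  simp [← this]

theorem pow_mem_weightedSpace {A e : ℕ} {f : BiPoly} (hf : f ∈ weightedSpace A e) (k : ℕ) :
    f ^ k ∈ weightedSpace A (k * e) := by
  induction k with
  | zero => simpa using C_mem_weightedSpace A 1
  | succ k ih => rw [pow_succ, Nat.succ_mul]; exact mul_mem_weightedSpace ih hf

theorem aeval_X_one_mem_weightedSpace (A : ℕ) {e : ℕ} {w : Polynomial ℂ} (hw : w.natDegree ≤ e) :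
    Polynomial.aeval (X 1 : BiPoly) w ∈ weightedSpace A e := by
  rw [Polynomial.aeval_eq_sum_range]
  refine Submodule.sum_mem _ fun i hi => Submodule.smul_mem _ _ ?_
  have := pow_mem_weightedSpace (X_one_mem_weightedSpace A) i
  refine weightedSpace_mono ?_ this
  have := Finset.mem_range.1 hi
  omega

theorem exists_eq_aeval_add_X_mul (q : BiPoly) :
    ∃ (w : Polynomial ℂ) (q' : BiPoly), q = Polynomial.aeval (X 1 : BiPoly) w + X 0 * q' := by
  induction q using MvPolynomial.induction_on with
  | C c => exact ⟨Polynomial.C c, 0, by simp [algebraMap_eq]⟩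
  | add p q hp hq =>
    obtain ⟨w, p', rfl⟩ := hp
    obtain ⟨v, q', rfl⟩ := hq
    exact ⟨w + v, p' + q', by simp only [map_add]; ring⟩
  | mul_X p i hp =>
    obtain ⟨w, p', rfl⟩ := hp
    fin_cases i
    · exact ⟨0, Polynomial.aeval (X 1 : BiPoly) w + X 0 * p', by simp; ring⟩
    · exact ⟨w * Polynomial.X, p' * X 1, by simp; ring⟩

/-- The jets of order `< μ i` at the points `(x i, y i)` of polynomials of weighted degree at most
`e` are arbitrary. -/
def JetSurjective (A e : ℕ) {ι : Type} (x y : ι → ℂ) (μ : ι → ℕ) : Prop :=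
  ∀ q : ι → BiPoly, ∃ g ∈ weightedSpace A e, ∀ i, g - q i ∈ pointIdeal (x i) (y i) ^ μ i

theorem exists_natDegree_le_pow_dvd_sub {ι : Type} [Fintype ι] {y : ι → ℂ}
    (hy : Function.Injective y) (μ : ι → ℕ) (a : Finset ι) {e : ℕ} (hμ : ∑ i ∈ a, μ i ≤ e + 1)
    (w : ι → Polynomial ℂ) :
    ∃ v : Polynomial ℂ, v.natDegree ≤ e ∧
      ∀ i ∈ a, (Polynomial.X - Polynomial.C (y i)) ^ μ i ∣ v - w i := by
  classical
  let P : Polynomial ℂ := ∏ i ∈ a, (Polynomial.X - Polynomial.C (y i)) ^ μ i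
  have hP : P.Monic := Polynomial.monic_prod_of_monic _ _
    fun i _ => (Polynomial.monic_X_sub_C _).pow _
  have hdeg : P.natDegree = ∑ i ∈ a, μ i := by
    rw [Polynomial.natDegree_prod_of_monic _ _ fun i _ => (Polynomial.monic_X_sub_C _).pow _]
    simp
  obtain ⟨v, hv⟩ := Ideal.exists_forall_sub_mem_ideal
    (I := fun i => Ideal.span {(Polynomial.X - Polynomial.C (y i)) ^ μ i}) (fun i j hij => by
      simp only [Function.onFun]
      rw [Ideal.isCoprime_span_singleton_iff]
      exact (Polynomial.pairwise_coprime_X_sub_C hy hij).pow) w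
  simp only [Ideal.mem_span_singleton] at hv
  refine ⟨v %ₘ P, ?_, fun i hi => ?_⟩
  · by_cases h1 : P = 1
    · simp [h1]
    · have := Polynomial.natDegree_modByMonic_lt v hP h1
      omega
  · have h1 : v %ₘ P - w i = (v - w i) - P * (v /ₘ P) := by
      rw [Polynomial.modByMonic_eq_sub_mul_div v P]; ring
    rw [h1]
    exact dvd_sub (hv i) (Dvd.dvd.mul_right (Finset.dvd_prod_of_mem
      (fun i => (Polynomial.X - Polynomial.C (y i)) ^ μ i) hi) _)

theorem JetSurjective.horace {A e : ℕ} {ι : Type} [Fintype ι] [DecidableEq ι] {x y : ι → ℂ}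
    {μ : ι → ℕ} {a : Finset ι} (hy : Function.Injective y) (hx : ∀ i, x i = 0 ↔ i ∈ a)
    (hμ : ∑ i ∈ a, μ i ≤ e + 1) (hA : A ≤ e)
    (h : JetSurjective A (e - A) x y (fun i => if i ∈ a then μ i - 1 else μ i)) :
    JetSurjective A e x y μ := by
  intro q
  choose w q' hq using fun i => exists_eq_aeval_add_X_mul (q i)
  obtain ⟨v, hv, hvd⟩ := exists_natDegree_le_pow_dvd_sub hy μ a hμ w
  have hu : ∀ i, i ∉ a → ∃ u, X 0 * u - 1 ∈ pointIdeal (x i) (y i) ^ μ i := fun i hi =>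
    exists_mul_sub_one_mem_pow (by simpa using fun h0 => hi ((hx i).1 h0)) _
  choose! u hu using hu
  obtain ⟨g, hg, hgq⟩ := h fun i => if i ∈ a then q' i
    else u i * (q i - Polynomial.aeval (X 1 : BiPoly) v)
  refine ⟨Polynomial.aeval (X 1 : BiPoly) v + X 0 * g, add_mem
    (aeval_X_one_mem_weightedSpace A hv) ?_, fun i => ?_⟩
  · have := mul_mem_weightedSpace (X_zero_mem_weightedSpace A) hg
    rwa [Nat.add_sub_cancel' hA] at this
  · have hgi := hgq i
    by_cases hi : i ∈ a
    · simp only [hi, if_true] at hgi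
      have h1 : Polynomial.aeval (X 1 : BiPoly) v + X 0 * g - q i =
          Polynomial.aeval (X 1 : BiPoly) (v - w i) + X 0 * (g - q' i) := by
        rw [map_sub, hq i, ← hq i]
        linear_combination -(hq i)
      rw [h1]
      refine add_mem ?_ ?_
      · obtain ⟨z, hz⟩ := hvd i hi
        rw [hz, map_mul, map_pow, map_sub, Polynomial.aeval_X, Polynomial.aeval_C]
        exact Ideal.mul_mem_right _ _ (Ideal.pow_mem_pow (X_one_sub_mem_pointIdeal _ _) _)
      · have hX : (X 0 : BiPoly) ∈ pointIdeal (x i) (y i) := by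
          have := X_zero_sub_mem_pointIdeal (x i) (y i)
          rwa [(hx i).2 hi, C_0, sub_zero, ← (hx i).2 hi] at this
        rcases Nat.eq_zero_or_pos (μ i) with h0 | h0
        · simp [h0]
        · have := Ideal.mul_mem_mul hX hgi
          rwa [← pow_succ', Nat.sub_add_cancel h0] at this
    · simp only [hi, if_false] at hgi
      have := add_mem (Ideal.mul_mem_left _ (X 0) hgi)
        (Ideal.mul_mem_right (q i - Polynomial.aeval (X 1 : BiPoly) v) _ (hu i hi))
      convert this using 1
      ring

theorem mul_sum_pred_le {ι : Type} (μ : ι → ℕ) (a : Finset ι) {m : ℕ} (hμ : ∀ i ∈ a, μ i ≤ m + 1) :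
    (m + 1) * ∑ i ∈ a, (μ i - 1) ≤ m * ∑ i ∈ a, μ i := by
  rw [Finset.mul_sum, Finset.mul_sum]
  refine Finset.sum_le_sum fun i hi => ?_
  have := hμ i hi
  rcases Nat.eq_zero_or_pos (μ i) with h | h
  · simp [h]
  · obtain ⟨k, hk⟩ := Nat.exists_eq_succ_of_ne_zero h.ne'
    rw [hk] at this ⊢
    simp only [Nat.succ_eq_add_one, Nat.add_sub_cancel]
    nlinarith

theorem sum_pred_le {ι : Type} (μ : ι → ℕ) (a : Finset ι) {m A e : ℕ}
    (hμ : ∀ i ∈ a, μ i ≤ m + 1) (hA : A * (m + 1) ≤ e) (hs : ∑ i ∈ a, μ i ≤ e + 1) :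
    ∑ i ∈ a, (μ i - 1) ≤ e - A + 1 := by
  have h1 := mul_sum_pred_le μ a hμ
  have h2 : A ≤ e := by nlinarith
  obtain ⟨e', rfl⟩ := Nat.exists_eq_add_of_le h2
  rw [Nat.add_sub_cancel_left]
  by_contra! h3
  nlinarith

theorem JetSurjective.of_forall_eq_zero {A : ℕ} {ι : Type} [Fintype ι] {y : ι → ℂ}
    (hy : Function.Injective y) (m : ℕ) : ∀ (e : ℕ) (μ : ι → ℕ), (∀ i, μ i ≤ m) → A * m ≤ e →
    ∑ i, μ i ≤ e + 1 → JetSurjective A e (fun _ => 0) y μ := by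
  classical
  induction m with
  | zero =>
    intro e μ hμ _ _ q
    refine ⟨0, zero_mem _, fun i => ?_⟩
    simp [Nat.le_zero.1 (hμ i)]
  | succ m ih =>
    intro e μ hμ hA hs
    have h2 : A ≤ e := by nlinarith
    refine JetSurjective.horace (a := Finset.univ) hy (by simp) hs h2 ?_
    refine ih _ _ (fun i => ?_) ?_ ?_
    · have := hμ i
      simp only [Finset.mem_univ, if_true]; omega
    · rw [Nat.mul_succ] at hA; omega
    · simpa using sum_pred_le μ Finset.univ (fun i _ => hμ i) hA hs

/-- The substitution `X ↦ X + a`, `Y ↦ Y + b`. -/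
def shiftHom (a b : ℂ) : BiPoly →ₐ[ℂ] BiPoly := aeval ![X 0 + C a, X 1 + C b]

@[simp] theorem shiftHom_C (a b c : ℂ) : shiftHom a b (C c) = C c := by
  simp [shiftHom, algebraMap_eq]

@[simp] theorem shiftHom_X_zero (a b : ℂ) : shiftHom a b (X 0) = X 0 + C a := by
  simp [shiftHom]

@[simp] theorem shiftHom_X_one (a b : ℂ) : shiftHom a b (X 1) = X 1 + C b := by
  simp [shiftHom]

theorem shiftHom_shiftHom_neg (a b : ℂ) (f : BiPoly) :
    shiftHom a b (shiftHom (-a) (-b) f) = f := by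
  have : (shiftHom a b).comp (shiftHom (-a) (-b)) = AlgHom.id ℂ _ := by
    ext i : 1
    fin_cases i <;> simp
  exact DFunLike.congr_fun this f

theorem shiftHom_neg_shiftHom (a b : ℂ) (f : BiPoly) :
    shiftHom (-a) (-b) (shiftHom a b f) = f := by
  simpa using shiftHom_shiftHom_neg (-a) (-b) f

theorem idealOfVars_eq_span : idealOfVars (Fin 2) ℂ = Ideal.span {X 0, X 1} := by
  rw [idealOfVars]
  congr 1
  ext f
  simp [Fin.exists_fin_two, eq_comm]

theorem map_shiftHom_pointIdeal_pow (a b : ℂ) (k : ℕ) :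
    (pointIdeal a b ^ k).map (shiftHom a b) = idealOfVars (Fin 2) ℂ ^ k := by
  rw [Ideal.map_pow, pointIdeal, Ideal.map_span, idealOfVars_eq_span, Set.image_pair]
  simp

theorem map_shiftHom_neg_idealOfVars_pow (a b : ℂ) (k : ℕ) :
    (idealOfVars (Fin 2) ℂ ^ k).map (shiftHom (-a) (-b)) = pointIdeal a b ^ k := by
  rw [Ideal.map_pow, pointIdeal, idealOfVars_eq_span, Ideal.map_span, Set.image_pair]
  simp [sub_eq_add_neg]

theorem mem_pointIdeal_pow_iff_shiftHom_mem {a b : ℂ} {k : ℕ} {f : BiPoly} :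
    f ∈ pointIdeal a b ^ k ↔ shiftHom a b f ∈ idealOfVars (Fin 2) ℂ ^ k := by
  constructor
  · intro h
    rw [← map_shiftHom_pointIdeal_pow a b]
    exact Ideal.mem_map_of_mem _ h
  · intro h
    rw [← shiftHom_neg_shiftHom a b f, ← map_shiftHom_neg_idealOfVars_pow a b]
    exact Ideal.mem_map_of_mem _ h

theorem mem_pointIdeal_pow_iff {a b : ℂ} {k : ℕ} {f : BiPoly} :
    f ∈ pointIdeal a b ^ k ↔ ∀ n : Fin 2 →₀ ℕ, n.degree < k → coeff n (shiftHom a b f) = 0 := by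
  rw [mem_pointIdeal_pow_iff_shiftHom_mem, mem_pow_idealOfVars_iff']

theorem exists_polynomial_eval_eq_coeff_shiftHom (a δ b : ℂ) (f : BiPoly) :
    ∀ n : Fin 2 →₀ ℕ, ∃ p : Polynomial ℂ,
      ∀ t, p.eval t = coeff n (shiftHom (a + t * δ) b f) := by
  classical
  induction f using MvPolynomial.induction_on with
  | C c => exact fun n => ⟨Polynomial.C (coeff n (C c)), by simp⟩
  | add f g hf hg =>
    intro n
    obtain ⟨p, hp⟩ := hf n
    obtain ⟨q, hq⟩ := hg n
    exact ⟨p + q, by simp [hp, hq]⟩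
  | mul_X f i hf =>
    intro n
    obtain ⟨p, hp⟩ := hf n
    obtain ⟨q, hq⟩ := hf (n - Finsupp.single i 1)
    fin_cases i
    · refine ⟨(if n 0 = 0 then 0 else q) + p * (Polynomial.C a + Polynomial.X * Polynomial.C δ),
        fun t => ?_⟩
      rw [Fin.zero_eta, map_mul, shiftHom_X_zero, mul_add (shiftHom _ _ _),
        mul_comm (shiftHom _ _ _) (C _)]
      simp only [coeff_add, coeff_mul_X', coeff_C_mul, Polynomial.eval_add, Polynomial.eval_mul, hp,
        Finsupp.mem_support_iff]
      by_cases h : n 0 = 0 <;> simp [h, hq] <;> ring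
    · refine ⟨(if n 1 = 0 then 0 else q) + p * Polynomial.C b, fun t => ?_⟩
      rw [Fin.mk_one, map_mul, shiftHom_X_one, mul_add (shiftHom _ _ _),
        mul_comm (shiftHom _ _ _) (C _)]
      simp only [coeff_add, coeff_mul_X', coeff_C_mul, Polynomial.eval_add, Polynomial.eval_mul, hp,
        Finsupp.mem_support_iff]
      by_cases h : n 1 = 0 <;> simp [h, hq] <;> ring

theorem finite_setOf_degree_lt (k : ℕ) : {n : Fin 2 →₀ ℕ | n.degree < k}.Finite := by
  refine Set.Finite.subset (Set.finite_Iic (Finsupp.equivFunOnFinite.symm fun _ => k)) ?_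
  intro n hn i
  have : n i ≤ n.degree := Finsupp.le_degree i n
  have h2 : n.degree < k := hn
  simp
  omega

theorem finite_setOf_det_coeff_shiftHom_eq_zero {J : Type} [Fintype J] [DecidableEq J]
    (x δ y : J → ℂ) (n : J → Fin 2 →₀ ℕ) (G : J → BiPoly)
    (hG : ∀ i j, coeff (n i) (shiftHom (x i) (y i) (G j)) = if i = j then 1 else 0) :
    {t : ℂ | (Matrix.of fun i j : J =>
      coeff (n i) (shiftHom (x i + t * δ i) (y i) (G j))).det = 0}.Finite := by
  choose p hp using fun (i j : J) =>
    exists_polynomial_eval_eq_coeff_shiftHom (x i) (δ i) (y i) (G j) (n i)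
  let M : Matrix J J (Polynomial ℂ) := Matrix.of p
  have hdet : ∀ t, M.det.eval t = (Matrix.of fun i j : J =>
      coeff (n i) (shiftHom (x i + t * δ i) (y i) (G j))).det := by
    intro t
    rw [← Polynomial.coe_evalRingHom, RingHom.map_det]
    congr 1
    ext i j
    simp [M, hp]
  have hM : M.det ≠ 0 := by
    intro h0
    have h1 := hdet 0
    have h2 : (Matrix.of fun i j : J =>
      coeff (n i) (shiftHom (x i + 0 * δ i) (y i) (G j))) = 1 := by
      ext i j
      simp [hG, Matrix.one_apply]
    rw [h0, Polynomial.eval_zero, h2, Matrix.det_one] at h1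
    exact zero_ne_one h1
  refine M.det.roots.toFinset.finite_toSet.subset fun t ht => ?_
  have ht' : M.det.eval t = 0 := (hdet t).trans ht
  simpa [hM] using ht'

theorem JetSurjective.exists_dual {A e : ℕ} {ι : Type} [DecidableEq ι] {x y : ι → ℂ}
    {μ : ι → ℕ} (h : JetSurjective A e x y μ) (j : ι) (n : Fin 2 →₀ ℕ) :
    ∃ g ∈ weightedSpace A e, ∀ i (l : Fin 2 →₀ ℕ), l.degree < μ i →
      coeff l (shiftHom (x i) (y i) g) = if i = j ∧ l = n then 1 else 0 := by
  classical
  obtain ⟨g, hg, hgq⟩ := h fun i => if i = j then shiftHom (-x j) (-y j) (monomial n 1) else 0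
  refine ⟨g, hg, fun i l hl => ?_⟩
  have := mem_pointIdeal_pow_iff.1 (hgq i) l hl
  rw [map_sub, coeff_sub, sub_eq_zero] at this
  rw [this]
  by_cases hij : i = j
  · subst hij
    rw [if_pos rfl, shiftHom_shiftHom_neg, coeff_monomial]
    simp [eq_comm]
  · simp [hij]

theorem JetSurjective.finite_not_add_mul {A e : ℕ} {ι : Type} [Fintype ι] {x y : ι → ℂ}
    {μ : ι → ℕ} (h : JetSurjective A e x y μ) (δ : ι → ℂ) :
    {t : ℂ | ¬ JetSurjective A e (fun i => x i + t * δ i) y μ}.Finite := by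
  classical
  have hfin : ∀ i, Finite {n : Fin 2 →₀ ℕ // n.degree < μ i} := fun i =>
    (finite_setOf_degree_lt (μ i)).to_subtype
  obtain ⟨J, hJ, p, n, hsurj, hinj, hdeg⟩ : ∃ (J : Type) (_ : Fintype J) (p : J → ι)
      (n : J → Fin 2 →₀ ℕ), (∀ i l, l.degree < μ i → ∃ j, p j = i ∧ n j = l) ∧
      (∀ j k, p j = p k → n j = n k → j = k) ∧ ∀ j, (n j).degree < μ (p j) :=
    ⟨Σ i, {n : Fin 2 →₀ ℕ // n.degree < μ i}, Fintype.ofFinite _, fun j => j.1, fun j => j.2.1,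
      fun i l hl => ⟨⟨i, l, hl⟩, rfl, rfl⟩, by
        rintro ⟨j, n, hn⟩ ⟨k, l, hl⟩ h1 h2
        dsimp only at h1 h2
        subst h1 h2
        rfl, fun j => j.2.2⟩
  choose G hG hGc using fun j => h.exists_dual (p j) (n j)
  refine (finite_setOf_det_coeff_shiftHom_eq_zero (fun j => x (p j)) (fun j => δ (p j))
    (fun j => y (p j)) n G fun i j => ?_).subset fun t ht => ?_
  · rw [hGc j (p i) (n i) (hdeg i)]
    exact if_congr ⟨fun hij => hinj _ _ hij.1 hij.2, fun hij => hij ▸ ⟨rfl, rfl⟩⟩ rfl rfl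
  rw [Set.mem_ofPred_eq]
  by_contra hdet
  refine ht fun q => ?_
  set B := Matrix.of fun i j : J =>
    coeff (n i) (shiftHom (x (p i) + t * δ (p i)) (y (p i)) (G j)) with hB
  let b : J → ℂ := fun i => coeff (n i) (shiftHom (x (p i) + t * δ (p i)) (y (p i)) (q (p i)))
  let c : J → ℂ := B⁻¹.mulVec b
  refine ⟨∑ j, c j • G j, sum_mem fun j _ => Submodule.smul_mem _ _ (hG j), fun i => ?_⟩
  rw [mem_pointIdeal_pow_iff]
  intro l hl
  obtain ⟨j, rfl, rfl⟩ := hsurj i l hl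
  have h1 : B.mulVec c = b := by
    rw [Matrix.mulVec_mulVec, Matrix.mul_nonsing_inv _ (isUnit_iff_ne_zero.2 hdet),
      Matrix.one_mulVec]
  have h2 := congrFun h1 j
  rw [map_sub, coeff_sub, sub_eq_zero, ← show b j = coeff (n j) (shiftHom _ _ _) from rfl, ← h2]
  simp [Matrix.mulVec, dotProduct, hB, coeff_sum, mul_comm]

theorem JetSurjective.exists_ne_zero_add_mul {A e : ℕ} {ι : Type} [Fintype ι] {x y : ι → ℂ}
    {μ : ι → ℕ} (h : JetSurjective A e x y μ) (δ : ι → ℂ) :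
    ∃ t : ℂ, t ≠ 0 ∧ JetSurjective A e (fun i => x i + t * δ i) y μ := by
  obtain ⟨t, ht⟩ := ((h.finite_not_add_mul δ).union (Set.finite_singleton 0)).exists_notMem
  simp only [Set.mem_union, Set.mem_ofPred_eq, Set.mem_singleton_iff, not_or, not_not] at ht
  exact ⟨t, ht.2, ht.1⟩

theorem exists_maximal_sum_le {ι : Type} [Fintype ι] [DecidableEq ι] (μ : ι → ℕ) {B : ℕ}
    (a : Finset ι) (ha : ∑ i ∈ a, μ i ≤ B) :
    ∃ a', a ⊆ a' ∧ ∑ i ∈ a', μ i ≤ B ∧ ∀ i ∉ a', B < ∑ i ∈ a', μ i + μ i := by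
  obtain ⟨a', ha', hmax⟩ := (Finset.univ.filter fun s => a ⊆ s ∧ ∑ i ∈ s, μ i ≤ B).exists_max_image
    Finset.card ⟨a, by simp [ha]⟩
  simp only [Finset.mem_filter, Finset.mem_univ, true_and] at ha' hmax
  refine ⟨a', ha'.1, ha'.2, fun i hi => ?_⟩
  by_contra! h
  have := hmax (insert i a') ⟨ha'.1.trans (Finset.subset_insert _ _), by
    rw [Finset.sum_insert hi]; omega⟩
  rw [Finset.card_insert_of_notMem hi] at this
  omega

theorem exists_jetSurjective_of_eq_zero_iff {A m : ℕ} {ι : Type} [Fintype ι] (hA : 0 < A)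
    {y : ι → ℂ} (hy : Function.Injective y) (e : ℕ) : ∀ (μ : ι → ℕ) (a : Finset ι),
    (∀ i, μ i ≤ m + 1) → ∑ i ∈ a, μ i ≤ e + 1 →
    A * ∑ i, μ i * (μ i + 1) + 2 * (A * (m + 1)) ^ 2 + 2 * (m + 1) * e ≤
      e ^ 2 + A * e →
    ∃ x : ι → ℂ, (∀ i, x i = 0 ↔ i ∈ a) ∧ JetSurjective A e x y μ := by
  classical
  induction e using Nat.strong_induction_on with
  | _ e ih =>
  intro μ a hμ ha hS
  have heA : A * (m + 1) ≤ e := by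
    by_contra! h
    have h1 : e ^ 2 ≤ (A * (m + 1)) ^ 2 := Nat.pow_le_pow_left h.le 2
    have h2 : A * e < (A * (m + 1)) ^ 2 := by nlinarith
    have h3 := Nat.zero_le (A * ∑ i, μ i * (μ i + 1))
    have h4 := Nat.zero_le (2 * (m + 1) * e)
    linarith
  have hAe : A ≤ e := by nlinarith
  obtain ⟨a', haa, ha', hmax⟩ := exists_maximal_sum_le μ a ha
  obtain ⟨x, hx, hs⟩ : ∃ x : ι → ℂ, (∀ i, x i = 0 ↔ i ∈ a') ∧ JetSurjective A e x y μ := by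
    by_cases hu : a' = Finset.univ
    · subst hu
      exact ⟨fun _ => 0, by simp, JetSurjective.of_forall_eq_zero hy (m + 1) e μ hμ heA ha'⟩
    · obtain ⟨j, hj⟩ : ∃ j, j ∉ a' := by
        by_contra! h
        exact hu (Finset.eq_univ_of_forall h)
      have hlow : e + 1 < ∑ i ∈ a', μ i + (m + 1) := (hmax j hj).trans_le (by have := hμ j; omega)
      set μ' : ι → ℕ := fun i => if i ∈ a' then μ i - 1 else μ i with hμ'
      have hsum' : ∑ i ∈ a', μ' i = ∑ i ∈ a', (μ i - 1) :=
        Finset.sum_congr rfl fun i hi => by simp [hμ', hi]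
      have hdrop : ∑ i, μ' i * (μ' i + 1) + 2 * ∑ i ∈ a', μ i = ∑ i, μ i * (μ i + 1) := by
        have h1 : ∑ i ∈ a', μ i = ∑ i, if i ∈ a' then μ i else 0 := by simp
        rw [h1, Finset.mul_sum, ← Finset.sum_add_distrib]
        refine Finset.sum_congr rfl fun i _ => ?_
        by_cases hi : i ∈ a'
        · simp only [hμ', hi, if_true]
          rcases Nat.eq_zero_or_pos (μ i) with h | h
          · simp [h]
          · obtain ⟨k, hk⟩ := Nat.exists_eq_succ_of_ne_zero h.ne'
            rw [hk]
            simp only [Nat.succ_eq_add_one, Nat.add_sub_cancel]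
            ring
        · simp [hμ', hi]
      obtain ⟨x, hx, hs⟩ := ih (e - A) (by omega) μ' a'
        (fun i => by have := hμ i; simp only [hμ']; split_ifs <;> omega)
        (hsum' ▸ sum_pred_le μ a' (fun i _ => hμ i) heA ha') (by
          obtain ⟨e', rfl⟩ := Nat.exists_eq_add_of_le hAe
          rw [Nat.add_sub_cancel_left]
          rw [← hdrop] at hS
          have h3 : A * (A + e' + 2) ≤ A * (∑ i ∈ a', μ i + (m + 1)) :=
            Nat.mul_le_mul_left _ (by omega)
          nlinarith)
      exact ⟨x, hx, hs.horace hy hx ha' hAe⟩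
  obtain ⟨t, ht, hts⟩ := hs.exists_ne_zero_add_mul fun i => if i ∈ a' \ a then 1 else 0
  refine ⟨_, fun i => ?_, hts⟩
  by_cases hi : i ∈ a
  · simp [hi, (hx i).2 (haa hi)]
  · by_cases hi' : i ∈ a'
    · simp [hi, hi', (hx i).2 hi', ht]
    · simp [hi, hi', hx i]

theorem exists_forall_ne_zero_jetSurjective {A m e : ℕ} {ι : Type} [Fintype ι] (hA : 0 < A)
    {y : ι → ℂ} (hy : Function.Injective y) {μ : ι → ℕ} (hμ : ∀ i, μ i ≤ m + 1)
    (hS : A * ∑ i, μ i * (μ i + 1) + 2 * (A * (m + 1)) ^ 2 + 2 * (m + 1) * e ≤ e ^ 2 + A * e) :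
    ∃ x : ι → ℂ, (∀ i, x i ≠ 0) ∧ JetSurjective A e x y μ := by
  obtain ⟨x, hx, hs⟩ := exists_jetSurjective_of_eq_zero_iff hA hy e μ ∅ hμ (by simp) hS
  exact ⟨x, fun i => by simp [hx], hs⟩

theorem JetSurjective.exists_add_mul_mem {A e : ℕ} {ι : Type} {x y : ι → ℂ} {μ : ι → ℕ}
    (h : JetSurjective A e x y μ) (c : ℂ) (s : ℕ) (w : BiPoly) :
    ∃ g ∈ weightedSpace A e, ∀ j, y j ≠ c →
      w + (X 1 - C c) ^ s * g ∈ pointIdeal (x j) (y j) ^ μ j := by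
  have hu : ∀ j, y j ≠ c → ∃ u, (X 1 - C c) ^ s * u - 1 ∈ pointIdeal (x j) (y j) ^ μ j :=
    fun j hj => exists_mul_sub_one_mem_pow (by simpa using pow_ne_zero s (sub_ne_zero.2 hj)) _
  choose! u hu using hu
  obtain ⟨g, hg, hgq⟩ := h fun j => -(u j * w)
  refine ⟨g, hg, fun j hj => ?_⟩
  have := sub_mem (Ideal.mul_mem_left _ ((X 1 - C c) ^ s) (hgq j))
    (Ideal.mul_mem_left _ w (hu j hj))
  convert this using 1
  ring

/-- The substitution `X ↦ X ^ (A * N)`, `Y ↦ Y ^ N`. -/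
def coverHom (A N : ℕ) : BiPoly →ₐ[ℂ] BiPoly := aeval ![X 0 ^ (A * N), X 1 ^ N]

@[simp] theorem coverHom_C (A N : ℕ) (c : ℂ) : coverHom A N (C c) = C c := by
  simp [coverHom, algebraMap_eq]

@[simp] theorem coverHom_X_zero (A N : ℕ) : coverHom A N (X 0) = X 0 ^ (A * N) := by
  simp [coverHom]

@[simp] theorem coverHom_X_one (A N : ℕ) : coverHom A N (X 1) = X 1 ^ N := by
  simp [coverHom]

theorem eval_coverHom (A N : ℕ) (a b : ℂ) (f : BiPoly) :
    eval ![a, b] (coverHom A N f) = eval ![a ^ (A * N), b ^ N] f := by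
  rw [coverHom, ← coe_aeval_eq_eval, ← coe_aeval_eq_eval]
  simp only [RingHom.coe_coe]
  rw [← AlgHom.comp_apply]
  congr 1
  ext i
  fin_cases i <;> simp

theorem totalDegree_coverHom_le {A N e : ℕ} {f : BiPoly} (hf : f ∈ weightedSpace A e) :
    (coverHom A N f).totalDegree ≤ N * e := by
  rw [mem_weightedSpace] at hf
  rw [f.as_sum, map_sum]
  refine totalDegree_finsetSum_le fun n hn => ?_
  have h1 := hf n (mem_support_iff.1 hn)
  have h2 : coverHom A N (monomial n (coeff n f)) =
      monomial (Finsupp.single 0 (A * N * n 0) + Finsupp.single 1 (N * n 1)) (coeff n f) := by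
    rw [coverHom, aeval_monomial, monomial_eq, Finsupp.prod_fintype _ _ (by simp)]
    rw [Finsupp.prod_fintype _ _ (by simp)]
    simp [algebraMap_eq, pow_mul]
  rw [h2]
  refine (totalDegree_monomial_le _ _).trans ?_
  rw [Finsupp.sum_fintype _ _ (by simp)]
  simp only [Finsupp.add_apply, Fin.sum_univ_two, Finsupp.single_apply, id]
  simp only [if_true, Fin.isValue, one_ne_zero, zero_ne_one, if_false]
  nlinarith

theorem X_zero_pow_sub_mem_pointIdeal (a b : ℂ) (n : ℕ) :
    X 0 ^ n - C (a ^ n) ∈ pointIdeal a b := by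
  rw [C_pow]
  exact Ideal.mem_of_dvd _ (sub_dvd_pow_sub_pow _ _ _) (X_zero_sub_mem_pointIdeal a b)

theorem X_one_pow_sub_mem_pointIdeal (a b : ℂ) (n : ℕ) :
    X 1 ^ n - C (b ^ n) ∈ pointIdeal a b := by
  rw [C_pow]
  exact Ideal.mem_of_dvd _ (sub_dvd_pow_sub_pow _ _ _) (X_one_sub_mem_pointIdeal a b)

theorem coverHom_mem_pointIdeal_pow {A N k : ℕ} {a b : ℂ} {f : BiPoly}
    (hf : f ∈ pointIdeal (a ^ (A * N)) (b ^ N) ^ k) :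
    coverHom A N f ∈ pointIdeal a b ^ k := by
  have h1 : (pointIdeal (a ^ (A * N)) (b ^ N)).map (coverHom A N) ≤ pointIdeal a b := by
    rw [pointIdeal, Ideal.map_span, Set.image_pair, Ideal.span_le, Set.pair_subset_iff]
    simp only [map_sub, coverHom_C, coverHom_X_zero, coverHom_X_one]
    exact ⟨X_zero_pow_sub_mem_pointIdeal a b _, X_one_pow_sub_mem_pointIdeal a b _⟩
  have h2 := Ideal.mem_map_of_mem (coverHom A N) hf
  rw [Ideal.map_pow] at h2
  exact Ideal.pow_right_mono h1 k h2

theorem mul_sub_mul_mem_pow {I : Ideal BiPoly} {f f' g g' : BiPoly} {a b : ℕ}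
    (hf : f - f' ∈ I ^ (a + 1)) (hf' : f' ∈ I ^ a) (hg : g - g' ∈ I ^ (b + 1)) (hg' : g' ∈ I ^ b) :
    f * g - f' * g' ∈ I ^ (a + b + 1) := by
  have h1 := Ideal.mul_mem_mul hf hg
  have h2 := Ideal.mul_mem_mul hf hg'
  have h3 := Ideal.mul_mem_mul hf' hg
  rw [← pow_add] at h1 h2 h3
  have h1' := Ideal.pow_le_pow_right (show a + b + 1 ≤ a + 1 + (b + 1) by omega) h1
  have h2' := Ideal.pow_le_pow_right (show a + b + 1 ≤ a + 1 + b by omega) h2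
  have h3' := Ideal.pow_le_pow_right (show a + b + 1 ≤ a + (b + 1) by omega) h3
  convert add_mem h1' (add_mem h2' h3') using 1
  ring

theorem pow_sub_pow_mem_pow {I : Ideal BiPoly} {f f' : BiPoly} (hf : f - f' ∈ I ^ 2)
    (hf' : f' ∈ I) (k : ℕ) : f ^ k - f' ^ k ∈ I ^ (k + 1) := by
  induction k with
  | zero => simp
  | succ k ih =>
    rw [pow_succ, pow_succ]
    exact mul_sub_mul_mem_pow ih (Ideal.pow_mem_pow hf' k) (b := 1) hf (by simpa using hf')

theorem pow_sub_C_sub_mem_sq {I : Ideal BiPoly} {f : BiPoly} {a : ℂ} (hf : f - C a ∈ I) (n : ℕ) :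
    f ^ n - C (a ^ n) - C (n * a ^ (n - 1)) * (f - C a) ∈ I ^ 2 := by
  obtain ⟨k, hk⟩ := Polynomial.powAddExpansion (C a) (f - C a) n
  rw [add_sub_cancel] at hk
  have h1 : f ^ n - C (a ^ n) - C (n * a ^ (n - 1)) * (f - C a) = k * (f - C a) ^ 2 := by
    rw [hk]
    simp only [C_mul, C_pow, map_natCast]
    ring
  rw [h1]
  exact Ideal.mul_mem_left _ _ (Ideal.pow_mem_pow hf 2)

theorem exists_coverHom_mul_pow_sub_mem {A N : ℕ} (hA : 0 < A) (hN : 0 < N) {a b : ℂ} (ha : a ≠ 0)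
    (hb : b ≠ 0) (i j : ℕ) :
    ∃ c : ℂ, c ≠ 0 ∧ coverHom A N ((X 0 - C (a ^ (A * N))) ^ i * (X 1 - C (b ^ N)) ^ j) -
      C c * ((X 0 - C a) ^ i * (X 1 - C b) ^ j) ∈ pointIdeal a b ^ (i + j + 1) := by
  have hAN : A * N ≠ 0 := (Nat.mul_pos hA hN).ne'
  refine ⟨((A * N : ℕ) * a ^ (A * N - 1)) ^ i * ((N : ℕ) * b ^ (N - 1)) ^ j,
    mul_ne_zero (pow_ne_zero _ (mul_ne_zero (Nat.cast_ne_zero.2 hAN) (pow_ne_zero _ ha)))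
    (pow_ne_zero _ (mul_ne_zero (Nat.cast_ne_zero.2 hN.ne') (pow_ne_zero _ hb))), ?_⟩
  have h0 := X_zero_sub_mem_pointIdeal a b
  have h1 := X_one_sub_mem_pointIdeal a b
  have h2 := pow_sub_pow_mem_pow (pow_sub_C_sub_mem_sq h0 (A * N)) (Ideal.mul_mem_left _ _ h0) i
  have h3 := pow_sub_pow_mem_pow (pow_sub_C_sub_mem_sq h1 N) (Ideal.mul_mem_left _ _ h1) j
  have h4 := mul_sub_mul_mem_pow h2 (Ideal.pow_mem_pow (Ideal.mul_mem_left _ _ h0) i) h3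
    (Ideal.pow_mem_pow (Ideal.mul_mem_left _ _ h1) j)
  convert h4 using 1
  simp only [map_mul, map_pow, map_sub, coverHom_X_zero, coverHom_X_one, coverHom_C, mul_pow]
  ring

section Cover

variable {A N e : ℕ} {ι : Type} {x y : ι → ℂ} {μ : ι → ℕ} {S R : ι → Finset ℂ}

theorem one_mem_weightedSpace (A e : ℕ) : (1 : BiPoly) ∈ weightedSpace A e :=
  weightedSpace_mono (Nat.zero_le e) (by simpa using C_mem_weightedSpace A 1)

theorem X_zero_sub_pow_mem_weightedSpace (A : ℕ) (c : ℂ) (k : ℕ) :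
    (X 0 - C c) ^ k ∈ weightedSpace A (k * A) :=
  pow_mem_weightedSpace (sub_mem (X_zero_mem_weightedSpace A)
    (weightedSpace_mono (Nat.zero_le _) (C_mem_weightedSpace A c))) k

theorem X_one_sub_pow_mem_weightedSpace (A : ℕ) (c : ℂ) (k : ℕ) :
    (X 1 - C c) ^ k ∈ weightedSpace A (k * 1) :=
  pow_mem_weightedSpace (sub_mem (X_one_mem_weightedSpace A)
    (weightedSpace_mono (Nat.zero_le _) (C_mem_weightedSpace A c))) k

/-- Membership in the ideal of polynomials with multiplicity at least `μ i` along the grid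
`S i × R i`, for every `i`. -/
def VanishesOnGrids (S R : ι → Finset ℂ) (μ : ι → ℕ) (f : BiPoly) : Prop :=
  ∀ i, ∀ a ∈ S i, ∀ b ∈ R i, f ∈ pointIdeal a b ^ μ i

theorem VanishesOnGrids.coverHom (hS : ∀ i, ∀ a ∈ S i, a ^ (A * N) = x i)
    (hR : ∀ i, ∀ b ∈ R i, b ^ N = y i) {f : BiPoly}
    (hf : ∀ i, f ∈ pointIdeal (x i) (y i) ^ μ i) : VanishesOnGrids S R μ (coverHom A N f) := by
  intro i a ha b hb
  refine coverHom_mem_pointIdeal_pow ?_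
  rw [hS i a ha, hR i b hb]
  exact hf i

theorem exists_vanishesOnGrids_eval_ne_zero (h : JetSurjective A e x y μ)
    (hy : Function.Injective y) {m T : ℕ} (hμ : ∀ i, 1 ≤ μ i ∧ μ i ≤ m) (heT : e + m + 2 ≤ T)
    (hAT : m * A + 1 ≤ T) (hS : ∀ i, ∀ a ∈ S i, a ^ (A * N) = x i)
    (hR : ∀ i, ∀ b ∈ R i, b ^ N = y i)
    (hSR : ∀ i, ((∀ a, a ^ (A * N) = x i → a ∈ S i) ∧ ∀ b, b ^ N = y i → b ∈ R i) ∨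
      (S i).card ≤ N ∧ (R i).card ≤ N) {a b : ℂ} (hab : ∀ i, ¬ (a ∈ S i ∧ b ∈ R i)) :
    ∃ f : BiPoly, f.totalDegree ≤ N * (T - 1) ∧ VanishesOnGrids S R μ f ∧
      eval ![a, b] f ≠ 0 := by
  by_cases hi : ∃ i, y i = b ^ N
  · obtain ⟨i, hi⟩ := hi
    by_cases hxi : x i = a ^ (A * N)
    · obtain ⟨v, hv, hvS, hva⟩ : ∃ v : BiPoly, v.totalDegree ≤ N ∧
          (∀ a ∈ S i, ∀ b ∈ R i, v ∈ pointIdeal a b) ∧ eval ![a, b] v ≠ 0 := by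
        have hcard : (S i).card ≤ N ∧ (R i).card ≤ N := by
          rcases hSR i with h | h
          · exact absurd ⟨h.1 a hxi.symm, h.2 b hi.symm⟩ (hab i)
          · exact h
        have hdeg : ∀ (l : Fin 2) (c : ℂ), (X l - C c : BiPoly).totalDegree ≤ 1 := fun l c =>
          (totalDegree_sub_C_le _ _).trans (by simp)
        by_cases ha : a ∈ S i
        · refine ⟨∏ c ∈ R i, (X 1 - C c), (totalDegree_finsetProd _ _).trans
            ((Finset.sum_le_card_nsmul _ _ 1 fun c _ => hdeg 1 c).trans (by simpa using hcard.2)),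
            fun a' _ b' hb' => Ideal.mem_of_dvd _ (Finset.dvd_prod_of_mem _ hb')
              (X_one_sub_mem_pointIdeal a' b'), ?_⟩
          rw [map_prod, Finset.prod_ne_zero_iff]
          intro c hc
          have : b ≠ c := by rintro rfl; exact hab i ⟨ha, hc⟩
          simpa [sub_eq_zero] using this
        · refine ⟨∏ c ∈ S i, (X 0 - C c), (totalDegree_finsetProd _ _).trans
            ((Finset.sum_le_card_nsmul _ _ 1 fun c _ => hdeg 0 c).trans (by simpa using hcard.1)),
            fun a' ha' b' _ => Ideal.mem_of_dvd _ (Finset.dvd_prod_of_mem _ ha')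
              (X_zero_sub_mem_pointIdeal a' b'), ?_⟩
          rw [map_prod, Finset.prod_ne_zero_iff]
          intro c hc
          have : a ≠ c := by rintro rfl; exact ha hc
          simpa [sub_eq_zero] using this
      obtain ⟨g, hg, hgj⟩ := h.exists_add_mul_mem (y i) 1 1
      refine ⟨v ^ μ i * coverHom A N (1 + (X 1 - C (y i)) ^ 1 * g), ?_, fun j a' ha' b' hb' => ?_,
        ?_⟩
      · have h1 := totalDegree_coverHom_le (N := N) (add_mem (one_mem_weightedSpace A (1 * 1 + e))
          (mul_mem_weightedSpace (X_one_sub_pow_mem_weightedSpace A (y i) 1) hg))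
        have h2 := totalDegree_pow v (μ i)
        have h3 : μ i * v.totalDegree ≤ m * N := Nat.mul_le_mul (hμ i).2 hv
        refine (totalDegree_mul _ _).trans ((add_le_add (h2.trans h3) h1).trans ?_)
        have : m + (1 * 1 + e) ≤ T - 1 := by omega
        calc m * N + N * (1 * 1 + e) = N * (m + (1 * 1 + e)) := by ring
          _ ≤ N * (T - 1) := Nat.mul_le_mul_left _ this
      · by_cases hj : j = i
        · subst hj
          exact Ideal.mul_mem_right _ _ (Ideal.pow_mem_pow (hvS a' ha' b' hb') _)
        · refine Ideal.mul_mem_left _ _ (coverHom_mem_pointIdeal_pow ?_)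
          rw [hS j a' ha', hR j b' hb']
          exact hgj j (hy.ne hj)
      · rw [map_mul, map_pow, eval_coverHom]
        refine mul_ne_zero (pow_ne_zero _ hva) ?_
        simp [hi]
    · obtain ⟨g, hg, hgj⟩ := h.exists_add_mul_mem (y i) (μ i) ((X 0 - C (x i)) ^ μ i)
      refine ⟨coverHom A N ((X 0 - C (x i)) ^ μ i + (X 1 - C (y i)) ^ μ i * g), ?_,
        VanishesOnGrids.coverHom hS hR fun j => ?_, ?_⟩
      · refine totalDegree_coverHom_le (add_mem
          (weightedSpace_mono ?_ (X_zero_sub_pow_mem_weightedSpace A (x i) (μ i)))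
          (weightedSpace_mono ?_
            (mul_mem_weightedSpace (X_one_sub_pow_mem_weightedSpace A (y i) (μ i)) hg)))
        · have := Nat.mul_le_mul_right A (hμ i).2
          omega
        · have := (hμ i).2
          omega
      · by_cases hj : j = i
        · subst hj
          exact add_mem (Ideal.pow_mem_pow (X_zero_sub_mem_pointIdeal _ _) _)
            (Ideal.mul_mem_right _ _ (Ideal.pow_mem_pow (X_one_sub_mem_pointIdeal _ _) _))
        · exact hgj j (hy.ne hj)
      · rw [eval_coverHom]
        have : μ i ≠ 0 := by have := (hμ i).1; omega
        simp [hi, this, sub_eq_zero, Ne.symm hxi]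
  · push Not at hi
    obtain ⟨g, hg, hgj⟩ := h.exists_add_mul_mem (b ^ N) 1 1
    refine ⟨coverHom A N (1 + (X 1 - C (b ^ N)) ^ 1 * g), ?_,
        VanishesOnGrids.coverHom hS hR fun j => hgj j (hi j), ?_⟩
    · refine totalDegree_coverHom_le (add_mem (one_mem_weightedSpace _ _) (weightedSpace_mono ?_
        (mul_mem_weightedSpace (X_one_sub_pow_mem_weightedSpace A (b ^ N) 1) hg)))
      omega
    · rw [eval_coverHom]
      simp

theorem exists_vanishesOnGrids_leading (h : JetSurjective A e x y μ) (hy : Function.Injective y)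
    (hA : 0 < A) (hN : 0 < N) {m T : ℕ} (hμ : ∀ i, 1 ≤ μ i ∧ μ i ≤ m) (heT : e + m + 2 ≤ T)
    (hAT : m * A + 1 ≤ T) (hx0 : ∀ i, x i ≠ 0) (hy0 : ∀ i, y i ≠ 0)
    (hS : ∀ i, ∀ a ∈ S i, a ^ (A * N) = x i) (hR : ∀ i, ∀ b ∈ R i, b ^ N = y i)
    (i : ι) {a b : ℂ} (ha : a ∈ S i) (hb : b ∈ R i) {k l : ℕ} (hkl : k + l = μ i) :
    ∃ f : BiPoly, f.totalDegree ≤ N * T ∧ VanishesOnGrids S R μ f ∧ ∃ c : ℂ, c ≠ 0 ∧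
      f - C c * ((X 0 - C a) ^ k * (X 1 - C b) ^ l) ∈ pointIdeal a b ^ (μ i + 1) := by
  have ha0 : a ≠ 0 := by
    rintro rfl
    exact hx0 i (by rw [← hS i 0 ha, zero_pow (Nat.mul_pos hA hN).ne'])
  have hb0 : b ≠ 0 := by
    rintro rfl
    exact hy0 i (by rw [← hR i 0 hb, zero_pow hN.ne'])
  obtain ⟨g, hg, hgj⟩ := h.exists_add_mul_mem (y i) (μ i + 1)
    ((X 0 - C (x i)) ^ k * (X 1 - C (y i)) ^ l)
  obtain ⟨c, hc, hcm⟩ := exists_coverHom_mul_pow_sub_mem hA hN ha0 hb0 k l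
  rw [hS i a ha, hR i b hb, hkl] at hcm
  refine ⟨coverHom A N ((X 0 - C (x i)) ^ k * (X 1 - C (y i)) ^ l +
    (X 1 - C (y i)) ^ (μ i + 1) * g), ?_, VanishesOnGrids.coverHom hS hR fun j => ?_, c, hc, ?_⟩
  · refine totalDegree_coverHom_le (add_mem
      (weightedSpace_mono ?_ (mul_mem_weightedSpace (X_zero_sub_pow_mem_weightedSpace A (x i) k)
        (X_one_sub_pow_mem_weightedSpace A (y i) l)))
      (weightedSpace_mono ?_
        (mul_mem_weightedSpace (X_one_sub_pow_mem_weightedSpace A (y i) (μ i + 1)) hg)))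
    · have h1 := Nat.mul_le_mul_right A (hμ i).2
      rw [← hkl] at h1
      nlinarith
    · have := (hμ i).2
      omega
  · by_cases hj : j = i
    · subst hj
      refine add_mem ?_ (Ideal.mul_mem_right _ _ (Ideal.pow_le_pow_right (Nat.le_succ _)
        (Ideal.pow_mem_pow (X_one_sub_mem_pointIdeal _ _) _)))
      rw [← hkl, pow_add]
      exact Ideal.mul_mem_mul (Ideal.pow_mem_pow (X_zero_sub_mem_pointIdeal _ _) _)
        (Ideal.pow_mem_pow (X_one_sub_mem_pointIdeal _ _) _)
    · exact hgj j (hy.ne hj)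
  · have h1 : coverHom A N ((X 1 - C (y i)) ^ (μ i + 1) * g) ∈ pointIdeal a b ^ (μ i + 1) := by
      refine coverHom_mem_pointIdeal_pow ?_
      rw [hS i a ha, hR i b hb]
      exact Ideal.mul_mem_right _ _ (Ideal.pow_mem_pow (X_one_sub_mem_pointIdeal _ _) _)
    have := add_mem hcm h1
    convert this using 1
    rw [map_add]
    ring

theorem exists_vanishesOnGrids_coeff_ne_zero (h : JetSurjective A e x y μ)
    (hN : 0 < N) {c₀ : ℕ} (heT : e < A * c₀) (hy0 : ∀ i, y i ≠ 0)
    (hS : ∀ i, ∀ a ∈ S i, a ^ (A * N) = x i) (hR : ∀ i, ∀ b ∈ R i, b ^ N = y i) (s : ℕ) :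
    ∃ f : BiPoly, f.totalDegree ≤ N * (A * c₀) + s ∧ VanishesOnGrids S R μ f ∧
      coeff (Finsupp.single 0 (N * (A * c₀) + s)) f ≠ 0 := by
  classical
  obtain ⟨g, hg, hgj⟩ := h.exists_add_mul_mem 0 0 (X 0 ^ c₀)
  simp only [pow_zero, one_mul] at hgj
  refine ⟨X 0 ^ s * coverHom A N (X 0 ^ c₀ + g), ?_, fun i a ha b hb => Ideal.mul_mem_left _ _
    (VanishesOnGrids.coverHom hS hR (fun j => hgj j (hy0 j)) i a ha b hb), ?_⟩
  · refine (totalDegree_mul _ _).trans ?_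
    rw [totalDegree_X_pow, add_comm]
    refine Nat.add_le_add_right (totalDegree_coverHom_le (add_mem ?_
      (weightedSpace_mono heT.le hg))) s
    rw [mul_comm]
    exact pow_mem_weightedSpace (X_zero_mem_weightedSpace A) c₀
  · have h1 : X 0 ^ s * coverHom A N (X 0 ^ c₀ + g) =
        X 0 ^ (N * (A * c₀) + s) + X 0 ^ s * coverHom A N g := by
      rw [map_add, map_pow, coverHom_X_zero]
      ring
    have h2 : coeff (Finsupp.single 0 (N * (A * c₀) + s)) (X 0 ^ s * coverHom A N g) = 0 := by
      refine coeff_eq_zero_of_totalDegree_lt ?_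
      rw [← Finsupp.degree_apply, Finsupp.degree_single]
      refine (totalDegree_mul _ _).trans_lt ?_
      rw [totalDegree_X_pow, add_comm]
      exact Nat.add_lt_add_right ((totalDegree_coverHom_le hg).trans_lt
        (Nat.mul_lt_mul_of_pos_left heT hN)) s
    rw [h1, coeff_add, h2, coeff_X_pow]
    simp

theorem exists_vanishesOnGrids_X_pow_add (h : JetSurjective A e x y μ)
    {T : ℕ} (heT : e < T) (hN : 0 < N) (hy0 : ∀ i, y i ≠ 0)
    (hS : ∀ i, ∀ a ∈ S i, a ^ (A * N) = x i) (hR : ∀ i, ∀ b ∈ R i, b ^ N = y i) (s : ℕ) :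
    ∃ f : BiPoly, f.totalDegree ≤ N * T + s ∧
      VanishesOnGrids S R μ (X 1 ^ (N * T + s + 1) + f) := by
  obtain ⟨g, hg, hgj⟩ := h.exists_add_mul_mem 0 0 (X 1 ^ T)
  simp only [pow_zero, one_mul] at hgj
  refine ⟨X 1 ^ (s + 1) * coverHom A N g, ?_, fun i a ha b hb => ?_⟩
  · refine (totalDegree_mul _ _).trans ?_
    rw [totalDegree_X_pow]
    have h1 := totalDegree_coverHom_le (N := N) hg
    have h2 := Nat.mul_lt_mul_of_pos_left heT hN
    omega
  · have h1 := Ideal.mul_mem_left _ (X 1 ^ (s + 1))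
      (VanishesOnGrids.coverHom hS hR (fun j => hgj j (hy0 j)) i a ha b hb)
    convert h1 using 1
    rw [map_add, map_pow, coverHom_X_one]
    ring

end Cover

theorem trdeg_intermediateField_adjoin_le {K : Type} [Field K] [Algebra K ℂ] (S : Set ℂ) :
    Algebra.trdeg K (IntermediateField.adjoin K S) ≤ Cardinal.mk S := by
  let s : Set (IntermediateField.adjoin K S) := Subtype.val ⁻¹' S
  have halg : ∀ (x : ℂ) (hx : x ∈ IntermediateField.adjoin K S),
      IsAlgebraic (Algebra.adjoin K s) (⟨x, hx⟩ : IntermediateField.adjoin K S) := by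
    intro x hx
    induction hx using IntermediateField.adjoin_induction with
    | mem x hx =>
      exact isAlgebraic_algebraMap (⟨⟨x, IntermediateField.subset_adjoin K S hx⟩,
        Algebra.subset_adjoin hx⟩ : Algebra.adjoin K s)
    | algebraMap x =>
      exact isAlgebraic_algebraMap (algebraMap K (Algebra.adjoin K s) x)
    | add x y hx hy h1 h2 => exact h1.add h2
    | mul x y hx hy h1 h2 => exact h1.mul h2
    | inv x hx h => exact h.inv
  have : Algebra.IsAlgebraic (Algebra.adjoin K s) (IntermediateField.adjoin K S) :=
    ⟨fun x => halg x.1 x.2⟩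
  exact (Algebra.IsAlgebraic.trdeg_le_cardinalMk K s).trans
    (Cardinal.mk_preimage_of_injective _ _ Subtype.val_injective)

theorem exists_algebraicIndependent (K : Subfield ℂ) (hK : Cardinal.mk K ≤ Cardinal.aleph0)
    (J : Type) [Finite J] : ∃ c : J → ℂ, AlgebraicIndependent K c := by
  obtain ⟨B, hB⟩ := exists_isTranscendenceBasis K ℂ
  have hinf : B.Infinite := by
    intro hfin
    have halg := hB.isAlgebraic
    rw [Subtype.range_coe] at halg
    have h1 : Algebra.IsAlgebraic (IntermediateField.adjoin K B) ℂ :=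
      ⟨fun x => IntermediateField.isAlgebraic_adjoin_iff.2 (halg.isAlgebraic x)⟩
    have h2 := Algebra.IsAlgebraic.cardinalMk_le_max (IntermediateField.adjoin K B) ℂ
    have h3 := IntermediateField.cardinalMk_adjoin_le K B
    have h4 : Cardinal.mk B ≤ Cardinal.aleph0 := hfin.countable.le_aleph0
    have h5 : Cardinal.mk ℂ ≤ Cardinal.aleph0 :=
      h2.trans (max_le (h3.trans (max_le (max_le hK h4) le_rfl)) le_rfl)
    exact absurd h5 (not_le.2 (by rw [Cardinal.mk_complex]; exact Cardinal.aleph0_lt_continuum))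
  have := hinf.to_subtype
  obtain ⟨f⟩ : Nonempty (J ↪ B) := by
    obtain ⟨n, ⟨g⟩⟩ := Finite.exists_equiv_fin J
    exact ⟨g.toEmbedding.trans (Fin.valEmbedding.trans (Infinite.natEmbedding B))⟩
  exact ⟨_, hB.1.comp f f.injective⟩

theorem Matrix.exists_submatrix_isUnit_of_mulVec_surjective {n : ℕ} {J : Type} [Fintype J]
    (M : Matrix (Fin n) J ℂ) (hM : Function.Surjective M.mulVec) :
    ∃ σ : Fin n → J, Function.Injective σ ∧ IsUnit (M.submatrix id σ) := by
  have hspan : Submodule.span ℂ (Set.range M.col) = ⊤ := by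
    rw [← Matrix.range_mulVecLin]
    exact LinearMap.range_eq_top.2 hM
  have hfr : Module.finrank ℂ (Submodule.span ℂ (Set.range M.col)) = n := by
    rw [hspan, finrank_top]
    simp
  have h := Submodule.exists_fun_fin_finrank_span_eq ℂ (Set.range M.col)
  rw [hfr] at h
  obtain ⟨f, hf, -, hli⟩ := h
  choose σ hσ using hf
  obtain rfl : f = M.col ∘ σ := funext fun i => (hσ i).symm
  refine ⟨σ, fun i j hij => hli.injective (by simp [hij]), ?_⟩
  exact Matrix.linearIndependent_cols_iff_isUnit.1 hli

theorem Matrix.inv_apply_mem {n : ℕ} (L : Subfield ℂ) {B : Matrix (Fin n) (Fin n) ℂ}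
    (hB : ∀ i j, B i j ∈ L) (i j : Fin n) : B⁻¹ i j ∈ L := by
  let B' : Matrix (Fin n) (Fin n) L := Matrix.of fun i j => ⟨B i j, hB i j⟩
  have h1 : L.subtype.mapMatrix B' = B := rfl
  rw [Matrix.inv_def, ← h1, ← RingHom.map_adjugate, ← RingHom.map_det, Ring.inverse_eq_inv']
  simp only [Matrix.smul_apply, smul_eq_mul]
  exact mul_mem (inv_mem (B'.det).2) (B'.adjugate i j).2

/-- A system of `s + 1` independent affine equations defined over `K(a₁, …, aₛ)` has no solution
which is algebraically independent over `K`. -/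
theorem exists_add_mulVec_ne_zero {K : Subfield ℂ} {J : Type} [Fintype J] {c : J → ℂ}
    (hc : AlgebraicIndependent K c) {s : ℕ} (a : Fin s → ℂ) (M : Matrix (Fin (s + 1)) J ℂ)
    (v : Fin (s + 1) → ℂ) (hM : Function.Surjective M.mulVec)
    (hMK : ∀ i j, M i j ∈ IntermediateField.adjoin K (Set.range a))
    (hvK : ∀ i, v i ∈ IntermediateField.adjoin K (Set.range a)) :
    ∃ i, v i + M.mulVec c i ≠ 0 := by
  classical
  by_contra! h
  obtain ⟨σ, hσ, hu⟩ := M.exists_submatrix_isUnit_of_mulVec_surjective hM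
  let T : Finset J := Finset.univ \ Finset.univ.image σ
  let S : Finset ℂ := Finset.univ.image a ∪ T.image c
  let L := IntermediateField.adjoin K (S : Set ℂ)
  have haL : IntermediateField.adjoin K (Set.range a) ≤ L := by
    refine IntermediateField.adjoin.mono _ _ _ ?_
    rintro _ ⟨i, rfl⟩
    simp [S]
  have hTL : ∀ j ∈ T, c j ∈ L := fun j hj => IntermediateField.subset_adjoin _ _
    (by simpa [S] using Or.inr ⟨j, hj, rfl⟩)
  set B := M.submatrix id σ with hB
  have hsum : ∀ i, B.mulVec (c ∘ σ) i = -v i - ∑ j ∈ T, M i j * c j := by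
    intro i
    have h1 : ∑ j, M i j * c j = ∑ j ∈ T, M i j * c j + ∑ j ∈ Finset.univ.image σ, M i j * c j :=
      (Finset.sum_sdiff (Finset.subset_univ _)).symm
    rw [Finset.sum_image hσ.injOn] at h1
    have h2 : M.mulVec c i = ∑ j, M i j * c j := rfl
    have h3 : B.mulVec (c ∘ σ) i = ∑ j, M i (σ j) * c (σ j) := rfl
    rw [h3]
    linear_combination h i - h2 - h1
  have hσL : ∀ k, c (σ k) ∈ L := by
    intro k
    have h1 : c ∘ σ = B⁻¹.mulVec (B.mulVec (c ∘ σ)) := by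
      rw [Matrix.mulVec_mulVec, Matrix.nonsing_inv_mul _ ((Matrix.isUnit_iff_isUnit_det _).1 hu),
        Matrix.one_mulVec]
    have h2 : c (σ k) = ∑ i, B⁻¹ k i * B.mulVec (c ∘ σ) i := congrFun h1 k
    rw [h2]
    refine sum_mem fun i _ => mul_mem
      (Matrix.inv_apply_mem L.toSubfield (fun i j => haL (hMK i (σ j))) k i) ?_
    rw [hsum]
    exact sub_mem (neg_mem (haL (hvK i)))
      (sum_mem fun j hj => mul_mem (haL (hMK i j)) (hTL j hj))
  have hL : ∀ j, c j ∈ L := by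
    intro j
    by_cases hj : j ∈ T
    · exact hTL j hj
    · simp only [T, Finset.mem_sdiff, Finset.mem_univ, true_and, Finset.mem_image, not_not] at hj
      obtain ⟨k, rfl⟩ := hj
      exact hσL k
  have hcL : AlgebraicIndependent K fun j => (⟨c j, hL j⟩ : L) :=
    AlgebraicIndependent.of_comp L.val hc
  have h1 := hcL.cardinalMk_le_trdeg.trans (trdeg_intermediateField_adjoin_le (S : Set ℂ))
  have h2 : Fintype.card J ≤ S.card := by
    simpa using h1
  have h3 : S.card ≤ s + T.card := (Finset.card_union_le _ _).trans
    (add_le_add (Finset.card_image_le.trans (by simp)) Finset.card_image_le)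
  have h4 : T.card + (s + 1) = Fintype.card J := by
    have := Finset.card_sdiff_add_card_eq_card (Finset.subset_univ (Finset.univ.image σ))
    rwa [Finset.card_image_of_injective _ hσ, Finset.card_fin, Finset.card_univ] at this
  omega

theorem exists_generic_mem_coset (G : Submodule ℂ BiPoly) [Module.Finite ℂ G] (f₀ : BiPoly)
    (Z : Set ℂ) (hZ : Z.Finite) : ∃ (K : Subfield ℂ) (f : BiPoly), Z ⊆ K ∧ f - f₀ ∈ G ∧
      ∀ (s : ℕ) (a : Fin s → ℂ) (φ : Fin (s + 1) → BiPoly →ₗ[ℂ] ℂ),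
        (∀ i g, (∀ n, coeff n g ∈ K) → φ i g ∈ IntermediateField.adjoin K (Set.range a)) →
        (∀ v : Fin (s + 1) → ℂ, ∃ g ∈ G, ∀ i, φ i g = v i) → ∃ i, φ i f ≠ 0 := by
  let J := Fin (Module.finrank ℂ G)
  let B : Module.Basis J ℂ G := Module.finBasis ℂ G
  let W : Set ℂ := Z ∪ (Set.range (fun n => coeff n f₀) ∪
    ⋃ j, Set.range (fun n => coeff n (B j : BiPoly)))
  have hW : W.Countable := by
    refine hZ.countable.union ((Set.countable_range _).union ?_)
    exact Set.countable_iUnion fun j => Set.countable_range _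
  let K := Subfield.closure W
  have hK : Cardinal.mk K ≤ Cardinal.aleph0 :=
    (Subfield.cardinalMk_closure_le_max W).trans (max_le hW.le_aleph0 le_rfl)
  have hWK : W ⊆ K := Subfield.subset_closure
  obtain ⟨c, hc⟩ := exists_algebraicIndependent K hK J
  refine ⟨K, f₀ + ∑ j, c j • (B j : BiPoly), fun z hz => hWK (Or.inl hz), ?_, ?_⟩
  · rw [add_sub_cancel_left]
    exact Submodule.sum_mem _ fun j _ => Submodule.smul_mem _ _ (B j).2
  · intro s a φ hφ hsurj
    let M : Matrix (Fin (s + 1)) J ℂ := Matrix.of fun i j => φ i (B j)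
    have hM : Function.Surjective M.mulVec := by
      intro v
      obtain ⟨g, hg, hgv⟩ := hsurj v
      refine ⟨B.repr ⟨g, hg⟩, ?_⟩
      ext i
      have : g = ∑ j, B.repr ⟨g, hg⟩ j • (B j : BiPoly) := by
        have := congrArg G.subtype (B.sum_repr ⟨g, hg⟩)
        rw [map_sum] at this
        exact this.symm
      rw [← hgv i]
      conv_rhs => rw [this]
      simp [M, Matrix.mulVec, dotProduct, mul_comm]
    obtain ⟨i, hi⟩ := exists_add_mulVec_ne_zero hc a M (fun i => φ i f₀) hM
      (fun i j => hφ i _ fun n => hWK (Or.inr (Or.inr (Set.mem_iUnion.2 ⟨j, n, rfl⟩))))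
      (fun i => hφ i _ fun n => hWK (Or.inr (Or.inl ⟨n, rfl⟩)))
    refine ⟨i, ?_⟩
    simpa [M, Matrix.mulVec, dotProduct, mul_comm] using hi

theorem eval_mem_of_coeff_mem {L : Subfield ℂ} {f : BiPoly} (hf : ∀ n, coeff n f ∈ L) {a b : ℂ}
    (ha : a ∈ L) (hb : b ∈ L) : eval ![a, b] f ∈ L := by
  rw [eval_eq']
  refine sum_mem fun n _ => mul_mem (hf n) (prod_mem fun i _ => pow_mem ?_ _)
  fin_cases i <;> simpa

theorem coeff_pderiv_mem {L : Subfield ℂ} {f : BiPoly} (hf : ∀ n, coeff n f ∈ L) (i : Fin 2)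
    (n : Fin 2 →₀ ℕ) : coeff n (pderiv i f) ∈ L := by
  classical
  rw [f.as_sum, map_sum, coeff_sum]
  refine sum_mem fun k _ => ?_
  rw [pderiv_monomial, coeff_monomial]
  split_ifs
  · exact mul_mem (hf k) (natCast_mem L _)
  · exact zero_mem L

theorem coeff_shiftHom_mem {L : Subfield ℂ} {f : BiPoly} (hf : ∀ n, coeff n f ∈ L) {a b : ℂ}
    (ha : a ∈ L) (hb : b ∈ L) (n : Fin 2 →₀ ℕ) : coeff n (shiftHom a b f) ∈ L := by
  have key : shiftHom a b f ∈ (map (σ := Fin 2) L.subtype).range := by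
    rw [f.as_sum, map_sum]
    have hC : ∀ c ∈ L, (C c : BiPoly) ∈ (map (σ := Fin 2) L.subtype).range :=
      fun c hc => ⟨C ⟨c, hc⟩, by simp⟩
    have hX : ∀ i, (X i : BiPoly) ∈ (map (σ := Fin 2) L.subtype).range :=
      fun i => ⟨X i, by simp⟩
    refine sum_mem fun k _ => ?_
    rw [monomial_eq, map_mul, shiftHom_C, Finsupp.prod_fintype _ _ (by simp), map_prod]
    refine mul_mem (hC _ (hf k)) (prod_mem fun i _ => ?_)
    rw [map_pow]
    refine pow_mem ?_ _
    fin_cases i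
    · simpa using add_mem (hX 0) (hC a ha)
    · simpa using add_mem (hX 1) (hC b hb)
  obtain ⟨g, hg⟩ := key
  rw [← hg, coeff_map]
  exact (coeff n g).2

theorem coeff_homogeneousComponent_mem {L : Subfield ℂ} {f : BiPoly} (hf : ∀ n, coeff n f ∈ L)
    (k : ℕ) (n : Fin 2 →₀ ℕ) : coeff n (homogeneousComponent k f) ∈ L := by
  rw [coeff_homogeneousComponent]
  split_ifs
  · exact hf n
  · exact zero_mem L

theorem eval_aeval_X_one (f : BiPoly) (t : ℂ) :
    (aeval ![Polynomial.X, 1] f : Polynomial ℂ).eval t = eval ![t, 1] f := by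
  induction f using MvPolynomial.induction_on with
  | C a => simp
  | add p q hp hq => simp [hp, hq]
  | mul_X p i hp => fin_cases i <;> simp [hp]

theorem coeff_aeval_X_one {k : ℕ} {f : BiPoly} (hf : f.IsHomogeneous k) :
    (aeval ![Polynomial.X, 1] f : Polynomial ℂ).coeff k = coeff (Finsupp.single 0 k) f := by
  classical
  conv_lhs => rw [f.as_sum, map_sum]
  rw [Polynomial.finsetSum_coeff]
  have hterm : ∀ n ∈ f.support, (aeval ![Polynomial.X, 1] (monomial n (coeff n f)) :
      Polynomial ℂ).coeff k = if n = Finsupp.single 0 k then coeff n f else 0 := by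
    intro n hn
    rw [aeval_monomial, Finsupp.prod_fintype _ _ (by simp)]
    simp only [Fin.prod_univ_two, Matrix.cons_val_zero, Matrix.cons_val_one, one_pow, mul_one,
      Polynomial.algebraMap_eq, Polynomial.coeff_C_mul_X_pow]
    have hd : n 0 + n 1 = k := by
      have := hf (mem_support_iff.1 hn)
      rwa [Pi.one_def, ← Finsupp.degree_eq_weight_one, Finsupp.degree_eq_sum,
        Fin.sum_univ_two] at this
    have : k = n 0 ↔ n = Finsupp.single 0 k := by
      constructor
      · intro h
        ext i
        fin_cases i <;> simp <;> omega
      · intro h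
        rw [h]; simp
    simp only [this]
  rw [Finset.sum_congr rfl hterm, Finset.sum_ite_eq']
  split_ifs with h
  · rfl
  · exact (notMem_support_iff.1 h).symm

theorem squarefree_of_isHomogeneous {k : ℕ} {f : BiPoly} (hf : f.IsHomogeneous k)
    (hk : coeff (Finsupp.single 0 k) f ≠ 0)
    (ht : ∀ t, eval ![t, 1] f = 0 → eval ![t, 1] (pderiv 0 f) ≠ 0) : Squarefree f := by
  have hf0 : f ≠ 0 := by rintro rfl; simp at hk
  rintro p ⟨q, hq⟩
  let δ : BiPoly →ₐ[ℂ] Polynomial ℂ := aeval ![Polynomial.X, 1]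
  have hpq : p ≠ 0 ∧ q ≠ 0 := by
    constructor <;> rintro rfl <;> simp at hq <;> exact hf0 hq
  have hδ0 : δ f ≠ 0 := by
    intro h
    apply hk
    rw [← coeff_aeval_X_one hf]
    change (δ f).coeff k = 0
    simp [h]
  have hδk : k ≤ (δ f).natDegree := by
    apply Polynomial.le_natDegree_of_ne_zero
    rw [← coeff_aeval_X_one hf] at hk
    exact hk
  have hδf : δ f = δ p * δ p * δ q := by rw [hq, map_mul, map_mul]
  have hδpq : δ p ≠ 0 ∧ δ q ≠ 0 := by
    constructor <;> intro h <;> rw [h] at hδf <;> simp at hδf <;> exact hδ0 hδf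
  have hconst : (δ p).natDegree = 0 := by
    by_contra hne
    obtain ⟨t, h⟩ := IsAlgClosed.exists_root (δ p) fun h =>
      hne (Polynomial.natDegree_eq_of_degree_eq_some h)
    have hpt : eval ![t, 1] p = 0 := by rw [← eval_aeval_X_one]; exact h
    refine ht t ?_ ?_
    · rw [hq]; simp [hpt]
    · rw [hq]; simp [hpt, Derivation.leibniz]
  have hdeg : (δ f).natDegree = (δ p).natDegree + (δ p).natDegree + (δ q).natDegree := by
    rw [hδf, Polynomial.natDegree_mul (mul_ne_zero hδpq.1 hδpq.1) hδpq.2,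
      Polynomial.natDegree_mul hδpq.1 hδpq.1]
  have htot : k = p.totalDegree + p.totalDegree + q.totalDegree := by
    rw [← hf.totalDegree hf0, hq, totalDegree_mul_of_isDomain (mul_ne_zero hpq.1 hpq.1) hpq.2,
      totalDegree_mul_of_isDomain hpq.1 hpq.1]
  have hq' : (δ q).natDegree ≤ q.totalDegree := by
    refine (aeval_natDegree_le q le_rfl _ fun i => ?_).trans (mul_one _).le
    fin_cases i <;> simp
  have hp : p.totalDegree = 0 := by omega
  refine isUnit_iff_totalDegree_of_isReduced.2 ⟨?_, hp⟩
  rw [isUnit_iff_ne_zero]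
  intro h
  rw [totalDegree_eq_zero_iff_eq_C.1 hp, h, C_0] at hpq
  exact hpq.1 rfl

theorem homogeneousComponent_shiftHom_of_sub_mem {f : BiPoly} {a b c : ℂ} {k l₀ l₁ : ℕ}
    (hl : l₀ + l₁ = k)
    (hf : f - C c * ((X 0 - C a) ^ l₀ * (X 1 - C b) ^ l₁) ∈ pointIdeal a b ^ (k + 1)) :
    homogeneousComponent k (shiftHom a b f) = C c * (X 0 ^ l₀ * X 1 ^ l₁) := by
  have hhom : (X 0 ^ l₀ * X 1 ^ l₁ : BiPoly).IsHomogeneous k := by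
    rw [← hl]
    simpa using ((isHomogeneous_X ℂ 0).pow l₀).mul ((isHomogeneous_X ℂ (1 : Fin 2)).pow l₁)
  have hzero : homogeneousComponent k
      (shiftHom a b (f - C c * ((X 0 - C a) ^ l₀ * (X 1 - C b) ^ l₁))) = 0 := by
    ext n
    rw [coeff_homogeneousComponent, coeff_zero]
    split_ifs with h
    · exact mem_pointIdeal_pow_iff.1 hf n (by omega)
    · rfl
  rw [map_sub, map_sub, sub_eq_zero] at hzero
  rw [hzero]
  simp only [map_mul, map_pow, map_sub, shiftHom_C, shiftHom_X_zero, shiftHom_X_one,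
    add_sub_cancel_right]
  rw [homogeneousComponent_C_mul, homogeneousComponent_of_mem hhom, if_pos rfl]

theorem exists_generic_curve {κ : Type} [Finite κ] {p q : κ → ℂ} {k : κ → ℕ} {n : ℕ}
    (hk : ∀ i, 1 ≤ k i)
    (hbase : ∀ a b, (∀ i, ¬(a = p i ∧ b = q i)) → ∃ f : BiPoly, f.totalDegree + 1 ≤ n ∧
      (∀ i, f ∈ pointIdeal (p i) (q i) ^ k i) ∧ eval ![a, b] f ≠ 0)
    (hlead : ∀ i l₀ l₁, l₀ + l₁ = k i → ∃ f : BiPoly, f.totalDegree ≤ n ∧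
      (∀ j, f ∈ pointIdeal (p j) (q j) ^ k j) ∧ ∃ c : ℂ, c ≠ 0 ∧
      f - C c * ((X 0 - C (p i)) ^ l₀ * (X 1 - C (q i)) ^ l₁) ∈ pointIdeal (p i) (q i) ^ (k i + 1))
    (htop : ∃ f : BiPoly, f.totalDegree ≤ n ∧ (∀ i, f ∈ pointIdeal (p i) (q i) ^ k i) ∧
      coeff (Finsupp.single 0 n) f ≠ 0)
    (hpow : ∃ f : BiPoly, f.totalDegree ≤ n ∧
      ∀ i, X 1 ^ (n + 1) + f ∈ pointIdeal (p i) (q i) ^ k i) :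
    ∃ g : BiPoly, g.totalDegree ≤ n ∧ coeff (Finsupp.single 0 n) g ≠ 0 ∧
      (∀ i, X 1 ^ (n + 1) + g ∈ pointIdeal (p i) (q i) ^ k i ∧
        homogeneousComponent (k i) (shiftHom (p i) (q i) (X 1 ^ (n + 1) + g)) ≠ 0 ∧
        Squarefree (homogeneousComponent (k i) (shiftHom (p i) (q i) (X 1 ^ (n + 1) + g)))) ∧
      ∀ a b, (∀ i, ¬(a = p i ∧ b = q i)) → eval ![a, b] (X 1 ^ (n + 1) + g) = 0 →
        ∃ j, eval ![a, b] (pderiv j (X 1 ^ (n + 1) + g)) ≠ 0 := by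
  obtain ⟨f₁, hf₁n, hf₁⟩ := hpow
  let G : Submodule ℂ BiPoly := restrictTotalDegree (Fin 2) ℂ n ⊓
    ⨅ i, (pointIdeal (p i) (q i) ^ k i).restrictScalars ℂ
  have hG : ∀ f, f ∈ G ↔ f.totalDegree ≤ n ∧ ∀ i, f ∈ pointIdeal (p i) (q i) ^ k i := by
    intro f
    simp only [G, Submodule.mem_inf, mem_restrictTotalDegree, Submodule.mem_iInf,
      Submodule.restrictScalars_mem]
  have : Module.Finite ℂ G := Submodule.finiteDimensional_inf_left _ _
  obtain ⟨K, f, hK, hfG, hgen⟩ := exists_generic_mem_coset G (X 1 ^ (n + 1) + f₁)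
    (Set.range p ∪ Set.range q) ((Set.finite_range p).union (Set.finite_range q))
  have hp : ∀ i, p i ∈ K := fun i => hK (Or.inl ⟨i, rfl⟩)
  have hq : ∀ i, q i ∈ K := fun i => hK (Or.inr ⟨i, rfl⟩)
  have hfn := (hG _).1 hfG
  have hKL : ∀ {s : ℕ} (a : Fin s → ℂ) {z : ℂ}, z ∈ K →
      z ∈ (IntermediateField.adjoin K (Set.range a)).toSubfield := fun a z hz =>
    (IntermediateField.adjoin K (Set.range a)).algebraMap_mem ⟨z, hz⟩
  have haL : ∀ {s : ℕ} (a : Fin s → ℂ) (i), a i ∈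
      (IntermediateField.adjoin K (Set.range a)).toSubfield := fun a i =>
    IntermediateField.subset_adjoin _ _ ⟨i, rfl⟩
  have hgen₀ : ∀ φ : BiPoly →ₗ[ℂ] ℂ, (∀ g, (∀ n, coeff n g ∈ K) →
      φ g ∈ IntermediateField.adjoin K (Set.range (![] : Fin 0 → ℂ))) →
      (∃ g ∈ G, φ g ≠ 0) → φ f ≠ 0 := by
    rintro φ hφ ⟨g, hg, hgφ⟩
    obtain ⟨-, h⟩ := hgen 0 ![] (fun _ => φ) (fun _ => hφ) fun v =>
      ⟨(v 0 / φ g) • g, G.smul_mem _ hg, fun i => by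
        rw [map_smul, smul_eq_mul, div_mul_cancel₀ _ hgφ, Fin.fin_one_eq_zero i]⟩
    exact h
  refine ⟨f - X 1 ^ (n + 1), ?_, ?_, ?_⟩
  · have : f - X 1 ^ (n + 1) = (f - (X 1 ^ (n + 1) + f₁)) + f₁ := by ring
    rw [this]
    exact (totalDegree_add _ _).trans (max_le hfn.1 hf₁n)
  · obtain ⟨h, hhn, hh, hc⟩ := htop
    have := hgen₀ (lcoeff ℂ (Finsupp.single 0 n)) (fun g hg => hKL _ (hg _))
      ⟨h, (hG h).2 ⟨hhn, hh⟩, hc⟩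
    rw [coeff_sub, coeff_X_pow, if_neg, sub_zero]
    · exact this
    · intro h
      simpa using DFunLike.congr_fun h 1
  rw [add_sub_cancel]
  refine ⟨fun i => ?_, ?_⟩
  · let Φ : BiPoly →ₗ[ℂ] BiPoly :=
      (homogeneousComponent (k i)) ∘ₗ (shiftHom (p i) (q i)).toLinearMap
    have hΦ : ∀ h, Φ h = homogeneousComponent (k i) (shiftHom (p i) (q i) h) := fun _ => rfl
    have hΦK : ∀ {s : ℕ} (a : Fin s → ℂ) {h : BiPoly}, (∀ n, coeff n h ∈ K) →
        ∀ n, coeff n (Φ h) ∈ (IntermediateField.adjoin K (Set.range a)).toSubfield :=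
      fun a h hh => coeff_homogeneousComponent_mem (coeff_shiftHom_mem
        (fun n => hKL a (hh n)) (hKL a (hp i)) (hKL a (hq i))) _
    have hΦl : ∀ l₀ l₁, l₀ + l₁ = k i → ∃ h ∈ G, Φ h = X 0 ^ l₀ * X 1 ^ l₁ := by
      intro l₀ l₁ hl
      obtain ⟨h, hhn, hh, c, hc, hhc⟩ := hlead i l₀ l₁ hl
      refine ⟨c⁻¹ • h, G.smul_mem _ ((hG h).2 ⟨hhn, hh⟩), ?_⟩
      rw [map_smul, hΦ, homogeneousComponent_shiftHom_of_sub_mem hl hhc, smul_eq_C_mul,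
        ← mul_assoc, ← C_mul, inv_mul_cancel₀ hc, C_1, one_mul]
    have hcoeff : coeff (Finsupp.single 0 (k i)) (Φ f) ≠ 0 := by
      obtain ⟨h, hh, hhΦ⟩ := hΦl (k i) 0 (add_zero _)
      refine hgen₀ (lcoeff ℂ (Finsupp.single 0 (k i)) ∘ₗ Φ) (fun g hg => hΦK _ hg _) ⟨h, hh, ?_⟩
      rw [LinearMap.comp_apply, hhΦ]
      simp [coeff_X_pow]
    refine ⟨?_, ?_, ?_⟩
    · simpa using add_mem (hfn.2 i) (hf₁ i)
    · intro h
      rw [hΦ, h] at hcoeff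
      simp at hcoeff
    · refine squarefree_of_isHomogeneous (homogeneousComponent_isHomogeneous _ _) hcoeff ?_
      intro t ht ht'
      obtain ⟨h₀, hh₀, hhΦ₀⟩ := hΦl 0 (k i) (zero_add _)
      obtain ⟨h₁, hh₁, hhΦ₁⟩ := hΦl 1 (k i - 1) (Nat.add_sub_cancel' (hk i))
      let φ : Fin 2 → BiPoly →ₗ[ℂ] ℂ := ![(aeval ![t, 1]).toLinearMap ∘ₗ Φ,
        (aeval ![t, 1]).toLinearMap ∘ₗ (pderiv 0).toLinearMap ∘ₗ Φ]
      have hφ₀ : ∀ g, φ 0 g = eval ![t, 1] (Φ g) := fun _ => rfl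
      have hφ₁ : ∀ g, φ 1 g = eval ![t, 1] (pderiv 0 (Φ g)) := fun _ => rfl
      have hφK : ∀ j g, (∀ n, coeff n g ∈ K) →
          φ j g ∈ IntermediateField.adjoin K (Set.range ![t]) := by
        intro j g hg
        fin_cases j
        · exact eval_mem_of_coeff_mem (hΦK _ hg) (haL ![t] 0) (one_mem _)
        · exact eval_mem_of_coeff_mem (coeff_pderiv_mem (hΦK _ hg) 0) (haL ![t] 0) (one_mem _)
      obtain ⟨j, hj⟩ := hgen 1 ![t] φ hφK fun v => by
        refine ⟨(v 0 - v 1 * t) • h₀ + v 1 • h₁,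
          add_mem (G.smul_mem _ hh₀) (G.smul_mem _ hh₁), fun j => ?_⟩
        fin_cases j
        · simp [hφ₀, hhΦ₀, hhΦ₁, smul_eval]
        · simp [hφ₁, hhΦ₀, hhΦ₁, Derivation.leibniz, smul_eval]
      fin_cases j
      · exact hj ht
      · exact hj ht'
  · intro a b hab hfab
    by_contra! hder
    obtain ⟨h, hhn, hh, he⟩ := hbase a b hab
    have hmem : ∀ u : BiPoly, u.totalDegree ≤ 1 → u * h ∈ G := fun u hu =>
      (hG _).2 ⟨(totalDegree_mul _ _).trans (by omega), fun i => Ideal.mul_mem_left _ _ (hh i)⟩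
    have hX : ∀ (i : Fin 2) (z : ℂ), (X i - C z : BiPoly).totalDegree ≤ 1 := fun i z =>
      (totalDegree_sub_C_le _ _).trans (totalDegree_X i).le
    let φ : Fin 3 → BiPoly →ₗ[ℂ] ℂ := ![(aeval ![a, b]).toLinearMap,
      (aeval ![a, b]).toLinearMap ∘ₗ (pderiv 0).toLinearMap,
      (aeval ![a, b]).toLinearMap ∘ₗ (pderiv 1).toLinearMap]
    have hφ₀ : ∀ g, φ 0 g = eval ![a, b] g := fun _ => rfl
    have hφ₁ : ∀ g, φ 1 g = eval ![a, b] (pderiv 0 g) := fun _ => rfl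
    have hφ₂ : ∀ g, φ 2 g = eval ![a, b] (pderiv 1 g) := fun _ => rfl
    have hφK : ∀ j g, (∀ n, coeff n g ∈ K) →
        φ j g ∈ IntermediateField.adjoin K (Set.range ![a, b]) := by
      intro j g hg
      have hg' : ∀ n, coeff n g ∈ (IntermediateField.adjoin K (Set.range ![a, b])).toSubfield :=
        fun n => hKL _ (hg n)
      fin_cases j
      · exact eval_mem_of_coeff_mem hg' (haL ![a, b] 0) (haL ![a, b] 1)
      · exact eval_mem_of_coeff_mem (coeff_pderiv_mem hg' 0) (haL ![a, b] 0) (haL ![a, b] 1)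
      · exact eval_mem_of_coeff_mem (coeff_pderiv_mem hg' 1) (haL ![a, b] 0) (haL ![a, b] 1)
    set e := eval ![a, b] h with he_def
    obtain ⟨j, hj⟩ := hgen 2 ![a, b] φ hφK fun v => by
      refine ⟨C (v 0 / e) * h + C ((v 1 - v 0 / e * φ 1 h) / e) * ((X 0 - C a) * h) +
        C ((v 2 - v 0 / e * φ 2 h) / e) * ((X 1 - C b) * h), ?_, fun j => ?_⟩
      · refine add_mem (add_mem ?_ ?_) ?_
        · exact hmem _ (by simp)
        · rw [← smul_eq_C_mul]
          exact G.smul_mem _ (hmem _ (hX 0 a))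
        · rw [← smul_eq_C_mul]
          exact G.smul_mem _ (hmem _ (hX 1 b))
      · fin_cases j
        · simp [hφ₀, ← he_def, he]
        · simp [hφ₁, ← he_def, Derivation.leibniz]
          field_simp
          ring
        · simp [hφ₂, ← he_def, Derivation.leibniz]
          field_simp
          ring
    fin_cases j
    · exact hj hfab
    · exact hj (hder 0)
    · exact hj (hder 1)

theorem MvPolynomial.IsHomogeneous.eval_smul {σ : Type} [Fintype σ] {f : MvPolynomial σ ℂ} {n : ℕ}
    (hf : f.IsHomogeneous n) (c : ℂ) (v : σ → ℂ) : eval (c • v) f = c ^ n * eval v f := by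
  rw [eval_eq', eval_eq', Finset.mul_sum]
  refine Finset.sum_congr rfl fun d hd => ?_
  have hdn : ∑ i, d i = n := by
    have := hf (mem_support_iff.1 hd)
    rwa [Pi.one_def, ← Finsupp.degree_eq_weight_one, Finsupp.degree_eq_sum] at this
  simp only [Pi.smul_apply, smul_eq_mul, mul_pow, Finset.prod_mul_distrib,
    Finset.prod_pow_eq_pow_sum, hdn]
  ring

theorem exists_homogenization {g : BiPoly} {n : ℕ} (hg : g.totalDegree ≤ n) :
    ∃ H : MvPolynomial (Fin 3) ℂ, H.IsHomogeneous n ∧ aeval ![X 0, X 1, (1 : BiPoly)] H = g ∧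
      eval ![1, 0, 0] H = coeff (Finsupp.single 0 n) g := by
  classical
  have hd : ∀ d ∈ g.support, d 0 + d 1 ≤ n := fun d hd => by
    have := (le_totalDegree hd).trans hg
    rwa [Finsupp.sum_fintype _ _ (by simp), Fin.sum_univ_two] at this
  refine ⟨∑ d ∈ g.support, C (coeff d g) * (X 0 ^ d 0 * X 1 ^ d 1 * X 2 ^ (n - (d 0 + d 1))),
    ?_, ?_, ?_⟩
  · refine IsHomogeneous.sum _ _ _ fun d hdg => IsHomogeneous.C_mul ?_ _
    have := ((isHomogeneous_X_pow (R := ℂ) (0 : Fin 3) (d 0)).mul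
      (isHomogeneous_X_pow (1 : Fin 3) (d 1))).mul
      (isHomogeneous_X_pow (2 : Fin 3) (n - (d 0 + d 1)))
    rwa [Nat.add_sub_cancel' (hd d hdg)] at this
  · conv_rhs => rw [g.as_sum]
    rw [map_sum]
    refine Finset.sum_congr rfl fun d _ => ?_
    rw [monomial_eq, Finsupp.prod_fintype _ _ (by simp), Fin.prod_univ_two]
    simp [algebraMap_eq]
  · rw [map_sum, Finset.sum_eq_single (Finsupp.single 0 n)]
    · simp
    · intro d hdg hdn
      have hd' : d 1 ≠ 0 ∨ n - (d 0 + d 1) ≠ 0 := by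
        by_contra! h
        refine hdn (Finsupp.ext fun i => ?_)
        have := hd d hdg
        fin_cases i <;> simp <;> omega
      rcases hd' with h | h <;> simp [h]
    · intro h
      simp [notMem_support_iff.1 h]

theorem irreducible_X_pow_add_X_mul {n : ℕ} {H : MvPolynomial (Fin 3) ℂ} (hH : H.IsHomogeneous n)
    (hH₀ : eval ![1, 0, 0] H ≠ 0) : Irreducible (X 1 ^ (n + 1) + X 2 * H) := by
  let ρ : MvPolynomial (Fin 3) ℂ →ₐ[ℂ] Polynomial ℂ := aeval ![1, Polynomial.X, 0]
  have hρ : ∀ f, (ρ f).natDegree ≤ f.totalDegree := fun f => by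
    refine (aeval_natDegree_le f le_rfl _ fun i => ?_).trans (mul_one _).le
    fin_cases i <;> simp
  have hρ₀ : ∀ f, (ρ f).eval 0 = eval ![1, 0, 0] f := fun f => by
    induction f using MvPolynomial.induction_on with
    | C a => simp [ρ]
    | add p q hp hq => simp [hp, hq]
    | mul_X p i hp => fin_cases i <;> simp [hp, ρ]
  set F : MvPolynomial (Fin 3) ℂ := X 1 ^ (n + 1) + X 2 * H with hF
  have hρF : ρ F = Polynomial.X ^ (n + 1) := by simp [hF, ρ]
  have hFhom : F.IsHomogeneous (n + 1) := by
    refine (isHomogeneous_X_pow _ _).add ?_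
    rw [add_comm n]
    exact (isHomogeneous_X _ _).mul hH
  have hF0 : F ≠ 0 := by
    intro h
    rw [h, map_zero] at hρF
    exact pow_ne_zero _ Polynomial.X_ne_zero hρF.symm
  have hdeg := hFhom.totalDegree hF0
  have key : ∀ a b : MvPolynomial (Fin 3) ℂ, F = a * b → IsUnit (ρ a) → IsUnit a := by
    intro a b hab ha
    have ha0 : a ≠ 0 := by rintro rfl; simp at hab; exact hF0 hab
    have hb0 : b ≠ 0 := by rintro rfl; simp at hab; exact hF0 hab
    have h1 : n + 1 = (ρ a).natDegree + (ρ b).natDegree := by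
      have hne : ρ a * ρ b ≠ 0 := by
        rw [← map_mul, ← hab, hρF]
        exact pow_ne_zero _ Polynomial.X_ne_zero
      rw [← Polynomial.natDegree_mul (left_ne_zero_of_mul hne) (right_ne_zero_of_mul hne),
        ← map_mul, ← hab, hρF, Polynomial.natDegree_X_pow]
    rw [hab, totalDegree_mul_of_isDomain ha0 hb0] at hdeg
    have h2 := Polynomial.natDegree_eq_zero_of_isUnit ha
    have h3 := hρ b
    have h4 : a.totalDegree = 0 := by omega
    refine isUnit_iff_totalDegree_of_isReduced.2 ⟨?_, h4⟩
    rw [isUnit_iff_ne_zero]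
    intro h
    rw [totalDegree_eq_zero_iff_eq_C.1 h4, h, C_0] at ha0
    exact ha0 rfl
  refine ⟨fun h => ?_, fun a b hab => ?_⟩
  · have := (isUnit_iff_totalDegree_of_isReduced.1 h).2
    omega
  · have hab' : ρ a * ρ b = Polynomial.X ^ (n + 1) := by rw [← map_mul, ← hab, hρF]
    obtain ⟨i, -, hi⟩ := (dvd_prime_pow Polynomial.prime_X _).1 (Dvd.intro _ hab')
    obtain ⟨j, -, hj⟩ := (dvd_prime_pow Polynomial.prime_X _).1 (Dvd.intro_left _ hab')
    rcases Nat.eq_zero_or_pos i with rfl | hi0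
    · exact Or.inl (key a b hab (by simpa using hi))
    rcases Nat.eq_zero_or_pos j with rfl | hj0
    · exact Or.inr (key b a (hab.trans (mul_comm _ _)) (by simpa using hj))
    exfalso
    have hroot : ∀ f l, 0 < l → Associated (ρ f) (Polynomial.X ^ l) → eval ![1, 0, 0] f = 0 := by
      intro f l hl hfl
      rw [← hρ₀]
      obtain ⟨u, hu⟩ := hfl.symm
      rw [← hu]
      simp [hl.ne']
    have h1 := congrArg (fun f => eval ![1, 0, 0] (pderiv 2 f)) hab
    have hX : pderiv (2 : Fin 3) (X 1 : MvPolynomial (Fin 3) ℂ) = 0 := pderiv_X_of_ne (by decide)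
    simp [hF, Derivation.leibniz, Derivation.leibniz_pow, hroot a i hi0 hi, hroot b j hj0 hj, hX]
      at h1
    exact hH₀ h1

theorem chartPoly_eq_shiftHom (F : MvPolynomial (Fin 3) ℂ) (a b : ℂ) :
    chartPoly !![1, 0, a; 0, 1, b; 0, 0, 1] F =
      shiftHom a b (aeval ![X 0, X 1, (1 : BiPoly)] F) := by
  rw [chartPoly, ← AlgHom.comp_apply]
  congr 1
  ext i : 1
  fin_cases i <;> simp [Fin.sum_univ_three]

theorem exists_plane_curve {κ : Type} {p q : κ → ℂ} {k : κ → ℕ} {n : ℕ} {g : BiPoly}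
    (hpq : ∀ i j, p i = p j → q i = q j → i = j)
    (hg : g.totalDegree ≤ n) (htop : coeff (Finsupp.single 0 n) g ≠ 0)
    (hsing : ∀ i, X 1 ^ (n + 1) + g ∈ pointIdeal (p i) (q i) ^ k i ∧
      homogeneousComponent (k i) (shiftHom (p i) (q i) (X 1 ^ (n + 1) + g)) ≠ 0 ∧
      Squarefree (homogeneousComponent (k i) (shiftHom (p i) (q i) (X 1 ^ (n + 1) + g))))
    (hsmooth : ∀ a b, (∀ i, ¬(a = p i ∧ b = q i)) → eval ![a, b] (X 1 ^ (n + 1) + g) = 0 →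
      ∃ j, eval ![a, b] (pderiv j (X 1 ^ (n + 1) + g)) ≠ 0) :
    ∃ (P : κ → Proj2) (F : MvPolynomial (Fin 3) ℂ), Function.Injective P ∧
      F.IsHomogeneous (n + 1) ∧ Irreducible F ∧ (∀ i, HasOrdinarySingularity (k i) (P i) F) ∧
      ∀ Q : Proj2, eval Q.rep F = 0 → (∀ i, Q ≠ P i) →
        ∃ j : Fin 3, eval Q.rep (pderiv j F) ≠ 0 := by
  obtain ⟨H, hH, hHg, hH₀⟩ := exists_homogenization hg
  rw [← hH₀] at htop
  set F : MvPolynomial (Fin 3) ℂ := X 1 ^ (n + 1) + X 2 * H with hF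
  let δ : MvPolynomial (Fin 3) ℂ →ₐ[ℂ] BiPoly := aeval ![X 0, X 1, 1]
  have hδF : δ F = X 1 ^ (n + 1) + g := by
    simp only [hF, δ, map_add, map_mul, map_pow, hHg, aeval_X]
    simp
  rw [← hδF] at hsing hsmooth
  have hFhom : F.IsHomogeneous (n + 1) := by
    refine (isHomogeneous_X_pow _ _).add ?_
    rw [add_comm n]
    exact (isHomogeneous_X _ _).mul hH
  have hne : ∀ a b : ℂ, ![a, b, 1] ≠ 0 := fun a b h => by simpa using congrFun h 2
  have hδ : ∀ a b f, eval ![a, b] (δ f) = eval ![a, b, 1] f := by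
    intro a b f
    induction f using MvPolynomial.induction_on with
    | C c => simp [δ]
    | add f₁ f₂ h₁ h₂ => simp [h₁, h₂]
    | mul_X f i h =>
      rw [map_mul, map_mul, map_mul, h]
      congr 1
      fin_cases i <;> simp [δ]
  have hδd : ∀ (j : Fin 2) f, pderiv j (δ f) = δ (pderiv j.castSucc f) := by
    intro j f
    induction f using MvPolynomial.induction_on with
    | C c => simp [δ]
    | add f₁ f₂ h₁ h₂ => simp [h₁, h₂]
    | mul_X f i h =>
      rw [map_mul, Derivation.leibniz, h, Derivation.leibniz]
      fin_cases i <;> fin_cases j <;> simp [δ, pderiv_X]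
  refine ⟨fun i => Projectivization.mk ℂ ![p i, q i, 1] (hne _ _), F, ?_, hFhom,
    irreducible_X_pow_add_X_mul hH htop, fun i => ?_, fun Q hQ hQP => ?_⟩
  · intro i j hij
    rw [Projectivization.mk_eq_mk_iff'] at hij
    obtain ⟨c, hc⟩ := hij
    have h2 : c = 1 := by simpa using congrFun hc 2
    subst h2
    exact (hpq j i (by simpa using congrFun hc 0) (by simpa using congrFun hc 1)).symm
  · have hvec : (!![1, 0, p i; 0, 1, q i; 0, 0, 1] : Matrix (Fin 3) (Fin 3) ℂ).mulVec ![0, 0, 1] =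
        ![p i, q i, 1] := by
      ext j
      fin_cases j <;> simp [Matrix.mulVec, dotProduct, Fin.sum_univ_three]
    refine ⟨!![1, 0, p i; 0, 1, q i; 0, 0, 1], ?_, ?_, ?_, ?_⟩
    · simp [Matrix.det_fin_three]
    · rw [hvec]; exact hne _ _
    · simp only [hvec]
    · rw [chartPoly_eq_shiftHom]
      refine ⟨fun l hl => ?_, (hsing i).2⟩
      ext d
      rw [coeff_homogeneousComponent, coeff_zero]
      split_ifs with h
      · exact mem_pointIdeal_pow_iff.1 (hsing i).1 d (by omega)
      · rfl
  · set v := Q.rep with hv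
    rcases eq_or_ne (v 2) 0 with h2 | h2
    · have h1 : v 1 = 0 := by
        have : v 1 ^ (n + 1) = 0 := by simpa [hF, h2] using hQ
        exact pow_eq_zero_iff (Nat.succ_ne_zero n) |>.1 this
      have hv0 : v = v 0 • ![1, 0, 0] := by
        ext i
        fin_cases i <;> simp [h1, h2]
      have h0 : v 0 ≠ 0 := by
        intro h
        rw [h, zero_smul] at hv0
        exact Q.rep_nonzero hv0
      refine ⟨2, ?_⟩
      have hX : pderiv (2 : Fin 3) (X 1 : MvPolynomial (Fin 3) ℂ) = 0 := pderiv_X_of_ne (by decide)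
      have : eval v (pderiv 2 F) = eval v H := by
        simp [hF, Derivation.leibniz, Derivation.leibniz_pow, hX, h2]
      rw [this, hv0, hH.eval_smul]
      exact mul_ne_zero (pow_ne_zero _ h0) htop
    · have hv2 : v = v 2 • ![v 0 / v 2, v 1 / v 2, 1] := by
        ext i
        fin_cases i <;> simp [mul_div_cancel₀, h2]
      have hQmk : Q = Projectivization.mk ℂ ![v 0 / v 2, v 1 / v 2, 1] (hne _ _) := by
        rw [← Q.mk_rep, Projectivization.mk_eq_mk_iff']
        exact ⟨v 2, hv2.symm⟩
      obtain ⟨j, hj⟩ := hsmooth (v 0 / v 2) (v 1 / v 2) (fun i hi => hQP i (by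
        rw [hQmk]; simp only [hi.1, hi.2])) (by
        rw [hδ]
        rw [hv2, hFhom.eval_smul] at hQ
        exact (mul_eq_zero.1 hQ).resolve_left (pow_ne_zero _ h2))
      refine ⟨j.castSucc, ?_⟩
      rw [hv2, hFhom.pderiv.eval_smul]
      rw [hδd, hδ] at hj
      exact mul_ne_zero (pow_ne_zero _ h2) hj

theorem exists_curve_of_jetSurjective {ι : Type} {A N m e c₀ s r : ℕ} {x y : ι → ℂ} {μ : ι → ℕ}
    {S R : ι → Finset ℂ} (h : JetSurjective A e x y μ) (hy : Function.Injective y) (hA : 0 < A)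
    (hN : 0 < N) (hμ : ∀ i, 1 ≤ μ i ∧ μ i ≤ m) (heT : e + m + 2 ≤ A * c₀)
    (hAT : m * A + 1 ≤ A * c₀) (hx0 : ∀ i, x i ≠ 0) (hy0 : ∀ i, y i ≠ 0)
    (hS : ∀ i, ∀ a ∈ S i, a ^ (A * N) = x i) (hR : ∀ i, ∀ b ∈ R i, b ^ N = y i)
    (hSR : ∀ i, ((∀ a, a ^ (A * N) = x i → a ∈ S i) ∧ ∀ b, b ^ N = y i → b ∈ R i) ∨
      (S i).card ≤ N ∧ (R i).card ≤ N) {mi : Fin r → ℕ} (E : Fin r ≃ Σ i, S i × R i)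
    (hmi : ∀ j, mi j = μ (E j).1) :
    ∃ (P : Fin r → Proj2) (F : MvPolynomial (Fin 3) ℂ), Function.Injective P ∧
      F ∈ homogeneousSubmodule (Fin 3) ℂ (N * (A * c₀) + s + 1) ∧ Irreducible F ∧
      (∀ i, HasOrdinarySingularity (mi i) (P i) F) ∧ SmoothAwayFrom F P := by
  let p : Fin r → ℂ := fun j => (E j).2.1
  let q : Fin r → ℂ := fun j => (E j).2.2
  have hgrid : ∀ {f : BiPoly}, VanishesOnGrids S R μ f → ∀ j,
      f ∈ pointIdeal (p j) (q j) ^ mi j := by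
    intro f hf j
    rw [hmi]
    exact hf _ _ (E j).2.1.2 _ (E j).2.2.2
  have hext : ∀ u v : Σ i, S i × R i, u.2.1.1 = v.2.1.1 → u.2.2.1 = v.2.2.1 → u = v := by
    intro u v h1 h2
    have h3 : u.1 = v.1 := by
      apply hy
      rw [← hR _ _ u.2.2.2, ← hR _ _ v.2.2.2, h2]
    obtain ⟨i, a, b⟩ := u
    obtain ⟨j, a', b'⟩ := v
    obtain rfl : i = j := h3
    obtain rfl : a = a' := Subtype.ext h1
    obtain rfl : b = b' := Subtype.ext h2
    rfl
  have hpq : ∀ i j, p i = p j → q i = q j → i = j := fun i j hp hq => E.injective (hext _ _ hp hq)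
  have hbase : ∀ a b, (∀ i, ¬(a = p i ∧ b = q i)) → ∃ f : BiPoly,
      f.totalDegree + 1 ≤ N * (A * c₀) + s ∧ (∀ i, f ∈ pointIdeal (p i) (q i) ^ mi i) ∧
      eval ![a, b] f ≠ 0 := by
    intro a b hab
    obtain ⟨f, hf, hfv, hfe⟩ := exists_vanishesOnGrids_eval_ne_zero h hy hμ heT hAT hS hR hSR
      (a := a) (b := b) fun i hi =>
        hab (E.symm ⟨i, ⟨a, hi.1⟩, ⟨b, hi.2⟩⟩) (by
          dsimp only [p, q]
          rw [E.apply_symm_apply]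
          exact ⟨rfl, rfl⟩)
    refine ⟨f, ?_, hgrid hfv, hfe⟩
    have : N * (A * c₀ - 1) + N = N * (A * c₀) := by
      rw [← Nat.mul_succ]
      congr 1
      omega
    omega
  have hlead : ∀ i l₀ l₁, l₀ + l₁ = mi i → ∃ f : BiPoly, f.totalDegree ≤ N * (A * c₀) + s ∧
      (∀ j, f ∈ pointIdeal (p j) (q j) ^ mi j) ∧ ∃ c : ℂ, c ≠ 0 ∧
      f - C c * ((X 0 - C (p i)) ^ l₀ * (X 1 - C (q i)) ^ l₁) ∈
        pointIdeal (p i) (q i) ^ (mi i + 1) := by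
    intro i l₀ l₁ hl
    obtain ⟨f, hf, hfv, c, hc, hfc⟩ := exists_vanishesOnGrids_leading h hy hA hN hμ heT hAT hx0 hy0
      hS hR (E i).1 (E i).2.1.2 (E i).2.2.2 (hl.trans (hmi i))
    refine ⟨f, hf.trans (Nat.le_add_right _ _), hgrid hfv, c, hc, ?_⟩
    rw [hmi]
    exact hfc
  obtain ⟨f, hf, hfv, hfc⟩ := exists_vanishesOnGrids_coeff_ne_zero h hN (by omega : e < A * c₀) hy0
    hS hR s
  obtain ⟨f', hf', hfv'⟩ := exists_vanishesOnGrids_X_pow_add h (by omega : e < A * c₀) hN hy0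
    hS hR s
  obtain ⟨g, hg, hgtop, hsing, hsmooth⟩ := exists_generic_curve
    (fun i => (hmi i).symm ▸ (hμ _).1) hbase hlead ⟨f, hf, hgrid hfv, hfc⟩ ⟨f', hf', hgrid hfv'⟩
  obtain ⟨P, F, hP, hF, hirr, hord, hsm⟩ := exists_plane_curve hpq hg hgtop hsing hsmooth
  exact ⟨P, F, hP, hF, hirr, hord, hsm⟩

theorem exists_finset_card_eq_forall_mem_iff_pow_eq {n : ℕ} (hn : 0 < n) {z : ℂ} (hz : z ≠ 0) :
    ∃ U : Finset ℂ, U.card = n ∧ ∀ a, a ∈ U ↔ a ^ n = z := by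
  classical
  have hsep : (Polynomial.X ^ n - Polynomial.C z).Separable :=
    Polynomial.separable_X_pow_sub_C z (by exact_mod_cast hn.ne') hz
  refine ⟨(Polynomial.X ^ n - Polynomial.C z).roots.toFinset, ?_, fun a => ?_⟩
  · rw [Multiset.toFinset_card_of_nodup (Polynomial.nodup_roots hsep),
      ← (IsAlgClosed.splits _).natDegree_eq_card_roots, Polynomial.natDegree_X_pow_sub_C]
  · rw [Multiset.mem_toFinset, Polynomial.mem_roots hsep.ne_zero]
    simp [sub_eq_zero]

theorem exists_subset_roots {n N c : ℕ} (hn : 0 < n) (hNn : N ≤ n) {z : ℂ} (hz : z ≠ 0)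
    (hc : c = n ∨ c ≤ N) : ∃ S : Finset ℂ, S.card = c ∧ (∀ a ∈ S, a ^ n = z) ∧
      (c = n → ∀ a, a ^ n = z → a ∈ S) := by
  obtain ⟨U, hU, hUz⟩ := exists_finset_card_eq_forall_mem_iff_pow_eq hn hz
  obtain ⟨S, hSU, hS⟩ := Finset.exists_subset_card_eq (s := U) (n := c) (by omega)
  refine ⟨S, hS, fun a ha => (hUz a).1 (hSU ha), fun h a ha => ?_⟩
  rw [Finset.eq_of_subset_of_card_le hSU (by omega)]
  exact (hUz a).2 ha

theorem exists_sum_rectangles (A : ℕ) {N : ℕ} (hN : 0 < N) (hA : 0 < A) (r : ℕ) :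
    ∃ (β : Type) (_ : Fintype β) (σ ρ : β → ℕ),
      (∀ b, σ b = A * N ∧ ρ b = N ∨ σ b ≤ N ∧ ρ b ≤ N) ∧ ∑ b, σ b * ρ b = r ∧
      Fintype.card β * (A * N ^ 2) ≤ r + (A + 1) * (A * N ^ 2) := by
  have hN2 : 0 < N ^ 2 := by positivity
  set r₁ := r % (A * N ^ 2) with hr₁
  set r₂ := r₁ % N ^ 2 with hr₂
  have h1 := Nat.div_add_mod r (A * N ^ 2)
  have h2 := Nat.div_add_mod r₁ (N ^ 2)
  have h3 := Nat.div_add_mod r₂ N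
  have hlt₁ : r₁ / N ^ 2 < A := by
    rw [Nat.div_lt_iff_lt_mul hN2]
    exact Nat.mod_lt _ (by positivity)
  have hlt₂ : r₂ / N < N := by
    rw [Nat.div_lt_iff_lt_mul hN, ← sq]
    exact Nat.mod_lt _ hN2
  refine ⟨Fin (r / (A * N ^ 2)) ⊕ Fin (r₁ / N ^ 2) ⊕ Unit ⊕ Unit, inferInstance,
    Sum.elim (fun _ => A * N) (Sum.elim (fun _ => N) (Sum.elim (fun _ => r₂ / N) (fun _ => 1))),
    Sum.elim (fun _ => N) (Sum.elim (fun _ => N) (Sum.elim (fun _ => N) (fun _ => r₂ % N))),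
    ?_, ?_, ?_⟩
  · rintro (b | b | b | b)
    · exact Or.inl ⟨rfl, rfl⟩
    · exact Or.inr ⟨le_rfl, le_rfl⟩
    · exact Or.inr ⟨hlt₂.le, le_rfl⟩
    · exact Or.inr ⟨hN, (Nat.mod_lt _ hN).le⟩
  · simp only [Fintype.sum_sum_type, Sum.elim_inl, Sum.elim_inr, Finset.sum_const,
      Finset.card_univ, Fintype.card_fin, smul_eq_mul, Fintype.card_unit, one_mul]
    rw [← hr₁] at h1
    rw [← hr₂] at h2
    linear_combination h1 + h2 + h3
  · simp only [Fintype.card_sum, Fintype.card_fin, Fintype.card_unit]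
    have : r₁ / N ^ 2 + 2 ≤ A + 1 := by omega
    calc _ = A * N ^ 2 * (r / (A * N ^ 2)) + (r₁ / N ^ 2 + 2) * (A * N ^ 2) := by ring
      _ ≤ _ := by
        gcongr
        omega

theorem exists_rectangles_of_multiplicities {m A N r : ℕ} (hN : 0 < N) (hA : 0 < A)
    {mi : Fin r → ℕ} (hmi : ∀ j, 1 ≤ mi j ∧ mi j ≤ m) :
    ∃ (ι : Type) (_ : Fintype ι) (μ σ ρ : ι → ℕ), (∀ i, 1 ≤ μ i ∧ μ i ≤ m) ∧
      (∀ i, σ i = A * N ∧ ρ i = N ∨ σ i ≤ N ∧ ρ i ≤ N) ∧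
      (∀ S R : ι → Finset ℂ, (∀ i, (S i).card = σ i) → (∀ i, (R i).card = ρ i) →
        ∃ E : Fin r ≃ Σ i, S i × R i, ∀ j, mi j = μ (E j).1) ∧
      (∑ i, μ i * (μ i + 1)) * (A * N ^ 2) ≤
        ∑ j, mi j * (mi j + 1) + m * (m * (m + 1)) * (A + 1) * (A * N ^ 2) := by
  let κ : Fin r → Fin m := fun j => ⟨mi j - 1, by have := hmi j; omega⟩
  have hκ : ∀ j, mi j = κ j + 1 := fun j => by
    have := (hmi j).1
    simp only [κ]
    omega
  choose β hβ σ ρ hσρ hsum hcard using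
    fun k : Fin m => exists_sum_rectangles A hN hA (Fintype.card {j // κ j = k})
  refine ⟨Σ k, β k, inferInstance, fun i => i.1 + 1, fun i => σ i.1 i.2, fun i => ρ i.1 i.2,
    fun i => ⟨Nat.le_add_left _ _, i.1.2⟩, fun i => hσρ i.1 i.2, fun S R hS hR => ?_, ?_⟩
  · have e : ∀ k, Nonempty ({j // κ j = k} ≃ Σ b : β k, S ⟨k, b⟩ × R ⟨k, b⟩) := fun k => by
      refine ⟨Fintype.equivOfCardEq ?_⟩
      simp [← hsum k, hS, hR]
    refine ⟨(Equiv.sigmaFiberEquiv κ).symm.trans ((Equiv.sigmaCongrRight fun k => (e k).some).trans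
      (Equiv.sigmaAssoc fun k b => S ⟨k, b⟩ × R ⟨k, b⟩).symm), fun j => hκ j⟩
  · have h1 : ∑ i : Σ k, β k, ((i.1 : ℕ) + 1) * (i.1 + 1 + 1) =
        ∑ k : Fin m, ((k : ℕ) + 1) * (k + 1 + 1) * Fintype.card (β k) := by
      rw [Fintype.sum_sigma]
      simp [mul_comm]
    have h2 : ∑ j, mi j * (mi j + 1) =
        ∑ k : Fin m, ((k : ℕ) + 1) * (k + 1 + 1) * Fintype.card {j // κ j = k} := by
      rw [← (Equiv.sigmaFiberEquiv κ).sum_comp, Fintype.sum_sigma]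
      refine Finset.sum_congr rfl fun k _ => ?_
      rw [mul_comm, ← smul_eq_mul, ← Finset.card_univ, ← Finset.sum_const]
      refine Finset.sum_congr rfl fun j _ => ?_
      change mi j.1 * (mi j.1 + 1) = _
      rw [hκ, j.2]
    have h3 : ∑ k : Fin m, ((k : ℕ) + 1) * (k + 1 + 1) ≤ m * (m * (m + 1)) := by
      refine (Finset.sum_le_card_nsmul _ _ (m * (m + 1)) fun k _ => ?_).trans (by simp)
      have := k.2
      gcongr <;> omega
    rw [h1, h2]
    calc (∑ k : Fin m, ((k : ℕ) + 1) * (k + 1 + 1) * Fintype.card (β k)) * (A * N ^ 2)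
        = ∑ k : Fin m, ((k : ℕ) + 1) * (k + 1 + 1) * (Fintype.card (β k) * (A * N ^ 2)) := by
          rw [Finset.sum_mul]
          simp only [mul_assoc]
      _ ≤ ∑ k : Fin m, ((k : ℕ) + 1) * (k + 1 + 1) *
            (Fintype.card {j // κ j = k} + (A + 1) * (A * N ^ 2)) := by
          gcongr with k
          exact hcard k
      _ = ∑ k : Fin m, ((k : ℕ) + 1) * (k + 1 + 1) * Fintype.card {j // κ j = k} +
            (∑ k : Fin m, ((k : ℕ) + 1) * (k + 1 + 1)) * ((A + 1) * (A * N ^ 2)) := by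
          rw [Finset.sum_mul, ← Finset.sum_add_distrib]
          simp only [mul_add]
      _ ≤ _ := by
          rw [mul_assoc (m * _)]
          gcongr

theorem sum_mul_succ_le {d r : ℕ} (mi : Fin r → ℕ)
    (h : 1 ≤ ((d : ℤ) + 1) * ((d : ℤ) + 2) / 2 - ∑ i, (mi i : ℤ) * ((mi i : ℤ) + 1) / 2) :
    ∑ i, mi i * (mi i + 1) ≤ d ^ 2 + 3 * d := by
  have h1 : ∀ a : ℤ, a * (a + 1) / 2 * 2 = a * (a + 1) := fun a =>
    Int.ediv_mul_cancel (Int.even_mul_succ_self a).two_dvd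
  have h2 := h1 (d + 1)
  rw [add_assoc, one_add_one_eq_two] at h2
  have h3 : (∑ i, (mi i : ℤ) * ((mi i : ℤ) + 1) / 2) * 2 = ∑ i, (mi i : ℤ) * ((mi i : ℤ) + 1) := by
    rw [Finset.sum_mul]
    exact Finset.sum_congr rfl fun i _ => h1 _
  zify
  rw [← h3]
  linarith

theorem mul_sum_le_of_le {A B N T d n s w : ℕ} (hN : 4 * (T + 2) ^ 2 ≤ N) (hs : s < T)
    (hd : d = N * T + s + 1) (h : n * (A * N ^ 2) ≤ w + B * (A * N ^ 2)) (hw : w ≤ d ^ 2 + 3 * d) :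
    A * n ≤ T ^ 2 + 1 + B * A := by
  have hNpos : 0 < N := by nlinarith
  have hdT : d ≤ N * T + T := by omega
  have h1 : d ^ 2 + 3 * d ≤ N ^ 2 * (T ^ 2 + 1) := by
    have h2 : d ^ 2 + 3 * d ≤ (N * T + T) ^ 2 + 3 * (N * T + T) := by gcongr
    have h3 : N * (4 * (T + 2) ^ 2) ≤ N * N := by gcongr
    nlinarith
  have h4 : N ^ 2 * (A * n) ≤ N ^ 2 * (T ^ 2 + 1 + B * A) := by linarith
  exact Nat.le_of_mul_le_mul_left h4 (by positivity)

/-- For every positive integer `m` there is a degree bound `D` such that for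
all `d ≥ D`, `r ≥ 1` and multiplicities `1 ≤ mᵢ ≤ m` with
`(d+1)(d+2)/2 − Σ mᵢ(mᵢ+1)/2 ≥ 1`, there exist pairwise distinct points `Pᵢ ∈ ℙ²(ℂ)` and an
irreducible homogeneous polynomial `F` of degree `d` with an ordinary singularity of
multiplicity `mᵢ` at each `Pᵢ`, whose zero curve is smooth away from the `Pᵢ`.
In particular `V(d; m₁, …, m_r)` is nonempty. -/
theorem existence_of_curves_with_ordinary_singularities :
    ∀ m : ℕ, 1 ≤ m → ∃ D : ℕ, ∀ d : ℕ, D ≤ d → ∀ r : ℕ, 1 ≤ r →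
      ∀ mi : Fin r → ℕ, (∀ i, 1 ≤ mi i ∧ mi i ≤ m) →
        1 ≤ ((d : ℤ) + 1) * ((d : ℤ) + 2) / 2 - ∑ i, (mi i : ℤ) * ((mi i : ℤ) + 1) / 2 →
        ∃ (P : Fin r → Proj2) (F : MvPolynomial (Fin 3) ℂ),
          Function.Injective P ∧
          F ∈ homogeneousSubmodule (Fin 3) ℂ d ∧
          Irreducible F ∧
          (∀ i, HasOrdinarySingularity (mi i) (P i) F) ∧
          SmoothAwayFrom F P := by
  intro m _
  set A := 4 * m + 7 with hA
  set B := m * (m * (m + 1)) * (A + 1) with hB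
  set c₀ := 1 + B * A + 2 * (A * (m + 1)) ^ 2 + (m + 2) ^ 2 + (m + 2) with hc₀
  set T := A * c₀ with hT
  have hA0 : 0 < A := by omega
  have hcT : c₀ ≤ T := Nat.le_mul_of_pos_left _ hA0
  refine ⟨4 * (T + 2) ^ 2 * T + 1, fun d hd r _ mi hmi h => ?_⟩
  have hT0 : 0 < T := by omega
  set N := (d - 1) / T with hN
  set s := (d - 1) % T with hs
  have hNs : N * T + s = d - 1 := Nat.div_add_mod' _ _
  have hdN : d = N * T + s + 1 := by omega
  have hNT : 4 * (T + 2) ^ 2 ≤ N := (Nat.le_div_iff_mul_le hT0).2 (by omega)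
  have hN0 : 0 < N := lt_of_lt_of_le (by positivity) hNT
  obtain ⟨ι, _, μ, σ, ρ, hμ, hσρ, hE, hμs⟩ := exists_rectangles_of_multiplicities hN0 hA0 hmi
  have hAμ := mul_sum_le_of_le hNT (Nat.mod_lt _ hT0) hdN hμs (sum_mul_succ_le mi h)
  obtain ⟨e, he⟩ : ∃ e, T = e + m + 2 := ⟨T - (m + 2), by omega⟩
  have hy : Function.Injective fun i : ι => ((Fintype.equivFin ι i : ℕ) : ℂ) + 1 := by
    intro i j hij
    simpa [← Fin.ext_iff] using hij
  obtain ⟨x, hx0, hx⟩ := exists_forall_ne_zero_jetSurjective (A := A) (m := m) (e := e) hA0 hy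
    (fun i => (hμ i).2.trans (Nat.le_succ m)) (by
      have : 1 + B * A + 2 * (A * (m + 1)) ^ 2 + (m + 2) ^ 2 ≤ e := by omega
      rw [he] at hAμ
      generalize A * ∑ i, μ i * (μ i + 1) = z at *
      generalize 2 * (A * (m + 1)) ^ 2 = w at *
      rw [hA]
      nlinarith)
  have hy0 : ∀ i : ι, ((Fintype.equivFin ι i : ℕ) : ℂ) + 1 ≠ 0 := fun i =>
    Nat.cast_add_one_ne_zero _
  have hNA : N ≤ A * N := Nat.le_mul_of_pos_left _ hA0
  choose S hSc hS hS' using fun i => exists_subset_roots (c := σ i) (Nat.mul_pos hA0 hN0) hNA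
    (hx0 i) ((hσρ i).imp And.left And.left)
  choose R hRc hR hR' using fun i => exists_subset_roots (c := ρ i) hN0 le_rfl
    (hy0 i) ((hσρ i).imp And.right And.right)
  obtain ⟨E, hE⟩ := hE S R hSc hRc
  rw [hdN]
  refine exists_curve_of_jetSurjective hx hy hA0 hN0 hμ he.ge ?_ hx0 hy0 hS hR (fun i => ?_) E hE
  · have : A * (m + 1) ≤ A * c₀ := Nat.mul_le_mul_left _ (by omega)
    linarith [mul_comm m A, mul_add A m 1]
  · rw [hSc, hRc]
    exact (hσρ i).imp_left fun hi => ⟨hS' i hi.1, hR' i hi.2⟩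

end
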